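/- arXiv:1807.01064 — 9 statements merged into one kernel-verified Lean document; each statement's English description precedes it below -/
import Mathlib

section
/- Let C be a linear code of length n over a finite field F, let i be a coordinate, and let R ⊆ Fin n be a set with i ∈ R. Then R is a recovery set for i (i.e., any two codewords of C that agree on all coordinates of R \ {i} also agree at coordinate i) if and only if there exists a vector v in the dual code C^⊥ such that v i ≠ 0 and the support of v is contained in R. -/
/-- A set `R ∋ i` is a recovery set for coordinate `i` of the linear code `C`
(any two codewords agreeing on `R \ {i}` agree at `i`) iff the dual code contains a
vector `v` with `v i ≠ 0` and support contained in `R`. -/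
theorem stmt_0 {F : Type*} [Field F] [Fintype F] {n : ℕ}
    (C : Submodule F (Fin n → F)) (i : Fin n) (R : Set (Fin n)) (hiR : i ∈ R) :
    (∀ c₁ ∈ C, ∀ c₂ ∈ C, (∀ j ∈ R \ {i}, c₁ j = c₂ j) → c₁ i = c₂ i) ↔
      ∃ v : Fin n → F, (∀ c ∈ C, ∑ j, v j * c j = 0) ∧ v i ≠ 0 ∧
        Function.support v ⊆ R := by
  classical
  constructor
  · intro h
    let L : Fin n → C →ₗ[F] F := fun j =>
      if j ∈ R \ {i} then LinearMap.proj j ∘ₗ C.subtype else 0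
    have hker : ⨅ j, LinearMap.ker (L j) ≤ LinearMap.ker (LinearMap.proj i ∘ₗ C.subtype) := by
      intro c hc
      rw [Submodule.mem_iInf] at hc
      refine h c c.2 0 C.zero_mem fun j hj => ?_
      have hcj : L j c = 0 := hc j
      simp only [L, if_pos hj] at hcj
      exact hcj
    obtain ⟨a, ha⟩ := Submodule.mem_span_range_iff_exists_fun F |>.mp
      (mem_span_of_iInf_ker_le_ker hker)
    refine ⟨fun j => (if j ∈ R \ {i} then a j else 0) - if j = i then 1 else 0, ?_, ?_, ?_⟩
    · intro c hc
      have hci : ∑ j, a j * L j ⟨c, hc⟩ = c i := by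
        simpa [LinearMap.sum_apply] using LinearMap.congr_fun ha ⟨c, hc⟩
      have hterm (j : Fin n) : a j * L j ⟨c, hc⟩ = (if j ∈ R \ {i} then a j else 0) * c j := by
        by_cases hj : j ∈ R \ {i}
        · simp only [L, if_pos hj]
          rfl
        · simp only [L, if_neg hj, LinearMap.zero_apply, mul_zero, zero_mul]
      simp only [sub_mul, Finset.sum_sub_distrib, ← hterm, hci]
      simp
    · simp
    · intro j hj
      by_contra hjR
      have hji : j ≠ i := fun h => hjR (h ▸ hiR)
      exact hj (by simp [hjR, hji])
  · rintro ⟨v, hv, hvi, hsupp⟩ c₁ h₁ c₂ h₂ hagree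
    have hsum := hv (c₁ - c₂) (C.sub_mem h₁ h₂)
    rw [Finset.sum_eq_single i _ (by simp)] at hsum
    · exact sub_eq_zero.mp ((mul_eq_zero.mp hsum).resolve_left hvi)
    · intro j _ hji
      by_cases hj : j ∈ R
      · simp [hagree j ⟨hj, hji⟩]
      · simp [Function.notMem_support.mp fun h => hj (hsupp h)]
end

section
/- Let n, k, d, r be positive integers with k ≥ 1 and d ≥ 2. If d = n - k - ⌈k/r⌉ + 2 (as integers, where ⌈k/r⌉ is the ceiling of the rational k/r), then n - k ≤ ⌈n/(r+1)⌉ + d - 2 - ⌊(d-2)/(r+1)⌋. -/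
/-- If `d = n - k - ⌈k/r⌉ + 2`, then `n - k ≤ ⌈n/(r+1)⌉ + d - 2 - ⌊(d-2)/(r+1)⌋`. -/
theorem stmt_2 (n k d r : ℕ) (hn : 0 < n) (hk : 1 ≤ k) (hd : 2 ≤ d) (hr : 0 < r)
    (hopt : (d : ℤ) = (n : ℤ) - k - ⌈(k : ℚ) / (r : ℚ)⌉ + 2) :
    (n : ℤ) - k ≤ ⌈(n : ℚ) / ((r : ℚ) + 1)⌉ + d - 2 - ⌊((d : ℚ) - 2) / ((r : ℚ) + 1)⌋ := by
  have hr' : (0 : ℚ) < r := by exact_mod_cast hr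
  have hc : ((⌈(k : ℚ) / r⌉ : ℤ) - 1 : ℚ) * r < k := by
    rw [← lt_div_iff₀ hr']
    linarith [Int.ceil_lt_add_one ((k : ℚ) / r)]
  have hf : (⌊((d : ℚ) - 2) / ((r : ℚ) + 1)⌋ : ℚ) * (r + 1) ≤ d - 2 := by
    rw [← le_div_iff₀ (by positivity)]
    exact Int.floor_le _
  have hopt' : (d : ℚ) = n - k - (⌈(k : ℚ) / r⌉ : ℤ) + 2 := by exact_mod_cast hopt
  have key : ⌈(k : ℚ) / r⌉ + ⌊((d : ℚ) - 2) / ((r : ℚ) + 1)⌋ - 1 < ⌈(n : ℚ) / ((r : ℚ) + 1)⌉ := by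
    rw [Int.lt_ceil, lt_div_iff₀ (by positivity)]
    push_cast
    linarith
  linarith [Int.le_of_sub_one_lt key]
end

section
/- Let C be an optimal LRC with locality r of length n over a finite field F, with dimension k ≥ 1 and minimum distance d ≥ 2, where (r+1) ∣ n. If n/(r+1) ≥ (d - 2 - ⌊(d-2)/(r+1)⌋)·(3r+2) + ⌊(d-2)/(r+1)⌋ + 1, then there exist n/(r+1) nonzero codewords c₁, …, c_{n/(r+1)} of the dual code C^⊥ whose supports are pairwise disjoint, each of size exactly r+1; in particular these supports partition Fin n into n/(r+1) disjoint recovery sets of size r+1. -/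
/-- The dual code of a linear code `C ⊆ F^n`. -/
def dualCode {F : Type*} [Field F] {n : ℕ} (C : Submodule F (Fin n → F)) :
    Set (Fin n → F) :=
  {v | ∀ c ∈ C, ∑ i, v i * c i = 0}

/-- `C` has locality `r`: every coordinate `i` has a dual codeword `v` with `v i ≠ 0`
whose support has size at most `r + 1`. -/
def HasLocality {F : Type*} [Field F] [DecidableEq F] {n : ℕ}
    (C : Submodule F (Fin n → F)) (r : ℕ) : Prop :=
  ∀ i : Fin n, ∃ v ∈ dualCode C, v i ≠ 0 ∧ hammingNorm v ≤ r + 1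

/-- `d` is the minimum Hamming distance (= least weight of a nonzero codeword) of `C`. -/
def IsMinDist {F : Type*} [Field F] [DecidableEq F] {n : ℕ}
    (C : Submodule F (Fin n → F)) (d : ℕ) : Prop :=
  IsLeast {w : ℕ | ∃ c ∈ C, c ≠ 0 ∧ hammingNorm c = w} d

open Finset in
/-- If the sets `S i`, of size at most `s + 1`, cover a finite type, then many of them have size
exactly `s + 1` and meet no other member of the family. -/
lemma exists_isolated_of_cover {ι α : Type*} [Fintype ι] [Fintype α]
    (S : ι → Finset α) (s : ℕ) (hS : ∀ i, #(S i) ≤ s + 1) (hcov : ∀ x, ∃ i, x ∈ S i) :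
    ∃ G : Finset ι, (∀ i ∈ G, #(S i) = s + 1 ∧ ∀ j, j ≠ i → Disjoint (S i) (S j)) ∧
      2 * Fintype.card α ≤ (2 * s + 1) * Fintype.card ι + #G := by
  classical
  let P : ι → Finset α := fun i => {x ∈ S i | ∀ j, j ≠ i → x ∉ S j}
  have hPS (i : ι) : P i ⊆ S i := filter_subset _ _
  refine ⟨univ.filter fun i => #(P i) = s + 1, fun i hi => ?_, ?_⟩
  · have hi' : #(P i) = s + 1 := by simpa using hi
    have heq : P i = S i := eq_of_subset_of_card_le (hPS i) (hi' ▸ hS i)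
    refine ⟨heq ▸ hi', fun j hj => Finset.disjoint_left.2 fun x hx => ?_⟩
    rw [← heq] at hx
    exact (mem_filter.1 hx).2 j hj
  · have hpoint (x : α) : 2 ≤ #{i | x ∈ S i} + #{i | x ∈ P i} := by
      obtain ⟨i, hi⟩ := hcov x
      by_cases h : ∀ j, j ≠ i → x ∉ S j
      · have h₁ : 0 < #{i | x ∈ S i} := card_pos.2 ⟨i, by simpa using hi⟩
        have h₂ : 0 < #{i | x ∈ P i} := card_pos.2 ⟨i, by simpa [P] using ⟨hi, h⟩⟩
        omega
      · push Not at h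
        obtain ⟨j, hji, hj⟩ := h
        have : 1 < #{i | x ∈ S i} :=
          one_lt_card.2 ⟨i, by simpa using hi, j, by simpa using hj, hji.symm⟩
        omega
    have hcount (T : ι → Finset α) : ∑ x, #{i | x ∈ T i} = ∑ i, #(T i) := by
      simp_rw [card_eq_sum_ones, sum_filter]
      rw [sum_comm]
      simp
    have hlow : 2 * Fintype.card α ≤ ∑ i, #(S i) + ∑ i, #(P i) := by
      rw [← hcount S, ← hcount P, ← sum_add_distrib, mul_comm, ← smul_eq_mul]
      exact card_nsmul_le_sum _ _ _ fun x _ => hpoint x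
    have hSsum : ∑ i, #(S i) ≤ Fintype.card ι * (s + 1) :=
      sum_le_card_nsmul _ _ _ fun i _ => hS i
    have hPsum : ∑ i, #(P i) ≤ ∑ i, (s + if #(P i) = s + 1 then 1 else 0) := by
      refine sum_le_sum fun i _ => ?_
      have := (card_le_card (hPS i)).trans (hS i)
      split_ifs <;> omega
    rw [sum_add_distrib, ← card_filter] at hPsum
    simp only [sum_const, card_univ, smul_eq_mul] at hPsum
    linarith

/-- A space and an independent family orthogonal to it have total dimension at most that of the
ambient coordinate space. -/
lemma finrank_add_card_le_of_orthogonal {F ι α : Type*} [Field F] [Fintype ι] [Fintype α]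
    (C : Submodule F (α → F)) (w : ι → α → F) (hw : LinearIndependent F w)
    (h : ∀ i, ∀ c ∈ C, ∑ x, w i x * c x = 0) :
    Module.finrank F C + Fintype.card ι ≤ Fintype.card α := by
  have hker : C ≤ LinearMap.ker (Matrix.of w).mulVecLin := by
    intro c hc
    rw [LinearMap.mem_ker]
    ext i
    exact h i c hc
  have hrank : (Matrix.of w).rank = Fintype.card ι := LinearIndependent.rank_matrix hw
  have hrn := LinearMap.finrank_range_add_finrank_ker (Matrix.of w).mulVecLin
  rw [Module.finrank_fintype_fun_eq_card] at hrn
  have := Submodule.finrank_mono hker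
  change Module.finrank F (LinearMap.range _) = _ at hrank
  omega

/-- If independent dual words are all supported in `U` and are too many for the size of `U`,
some nonzero codeword vanishes on `U`. -/
lemma exists_codeword_vanishing {F ι α : Type*} [Field F] [Fintype ι]
    [Fintype α] (C : Submodule F (α → F)) (w : ι → α → F) (hw : LinearIndependent F w)
    (h : ∀ i, ∀ c ∈ C, ∑ x, w i x * c x = 0) (U : Finset α) (hU : ∀ i, ∀ x ∉ U, w i x = 0)
    (hcard : U.card < Module.finrank F C + Fintype.card ι) :
    ∃ c ∈ C, c ≠ 0 ∧ ∀ x ∈ U, c x = 0 := by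
  by_contra! hcon
  let ρ : (α → F) →ₗ[F] (U → F) := LinearMap.funLeft F F Subtype.val
  have hindep : LinearIndependent F (ρ ∘ w) := by
    refine hw.map (Submodule.disjoint_def.2 fun v hv hv0 => ?_)
    have hoff : ∀ x ∉ U, v x = 0 := by
      intro x hx
      have hle : Submodule.span F (Set.range w) ≤ LinearMap.ker (LinearMap.proj x) := by
        rw [Submodule.span_le]
        rintro _ ⟨i, rfl⟩
        exact hU i x hx
      exact hle hv
    ext x
    by_cases hx : x ∈ U
    · exact congrFun hv0 ⟨x, hx⟩
    · exact hoff x hx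
  have hdim : Module.finrank F (C.map ρ) = Module.finrank F C := by
    rw [← LinearMap.range_domRestrict]
    refine LinearMap.finrank_range_of_inj ((injective_iff_map_eq_zero _).2 fun c hc => ?_)
    by_contra hne
    obtain ⟨x, hx, hx0⟩ := hcon c c.2 (by simpa using hne)
    exact hx0 (congrFun hc ⟨x, hx⟩)
  have := finrank_add_card_le_of_orthogonal (C.map ρ) (ρ ∘ w) hindep (by
    rintro i _ ⟨c, hc, rfl⟩
    have hsum := h i c hc
    rw [← Finset.sum_subset (Finset.subset_univ U) fun x _ hx => by simp [hU i x hx],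
      ← Finset.sum_coe_sort] at hsum
    exact hsum)
  rw [hdim, Fintype.card_coe] at this
  omega

/-- A code with locality `r` has an independent family of dual words of weight at most `r + 1`
whose supports cover all coordinates. -/
lemma HasLocality.exists_linearIndependent_cover {F : Type*} [Field F] [Fintype F] [DecidableEq F]
    {n r : ℕ} {C : Submodule F (Fin n → F)} (hloc : HasLocality C r) :
    ∃ B : Finset (Fin n → F), LinearIndependent F ((↑) : B → Fin n → F) ∧
      (∀ v ∈ B, v ∈ dualCode C ∧ hammingNorm v ≤ r + 1) ∧ ∀ i, ∃ v ∈ B, v i ≠ 0 := by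
  obtain ⟨b, hbs, hspan, hli⟩ :=
    exists_linearIndependent F {v : Fin n → F | v ∈ dualCode C ∧ hammingNorm v ≤ r + 1}
  lift b to Finset (Fin n → F) using b.toFinite
  refine ⟨b, hli, fun v hv => hbs hv, fun i => ?_⟩
  obtain ⟨v, hv, hvi, hvn⟩ := hloc i
  by_contra! hcon
  have hle : Submodule.span F (b : Set (Fin n → F)) ≤ LinearMap.ker (LinearMap.proj i) :=
    Submodule.span_le.2 fun u hu => hcon u hu
  refine hvi (hle ?_)
  rw [hspan]
  exact Submodule.subset_span ⟨hv, hvn⟩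

/-- The parameters of an optimal code with `n = (r + 1) * m`, where
`a = ⌊(d - 2) / (r + 1)⌋`. -/
lemma optimal_parameters {n r k d m : ℕ} (hr : 0 < r) (hn : n = (r + 1) * m)
    (hopt : (d : ℤ) = (n : ℤ) - k - ⌈(k : ℚ) / (r : ℚ)⌉ + 2) :
    ⌈(k : ℚ) / (r : ℚ)⌉ = m - ⌊((d : ℚ) - 2) / ((r : ℚ) + 1)⌋ ∧
      (r : ℤ) * ⌈(k : ℚ) / (r : ℚ)⌉ < k + r := by
  generalize hl : ⌈(k : ℚ) / (r : ℚ)⌉ = l at hopt ⊢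
  generalize ha : ⌊((d : ℚ) - 2) / ((r : ℚ) + 1)⌋ = a
  have hr' : (0 : ℚ) < r := by exact_mod_cast hr
  rw [Int.ceil_eq_iff, lt_div_iff₀ hr', div_le_iff₀ hr'] at hl
  rw [Int.floor_eq_iff, le_div_iff₀ (by positivity), div_lt_iff₀ (by positivity)] at ha
  obtain ⟨hl₁, hl₂⟩ := hl
  obtain ⟨ha₁, ha₂⟩ := ha
  have hl₁' : (l - 1) * (r : ℤ) < k := by exact_mod_cast hl₁
  have hl₂' : (k : ℤ) ≤ l * r := by exact_mod_cast hl₂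
  have ha₁' : a * ((r : ℤ) + 1) ≤ d - 2 := by exact_mod_cast ha₁
  have ha₂' : (d : ℤ) - 2 < (a + 1) * (r + 1) := by exact_mod_cast ha₂
  have hn' : (n : ℤ) = (r + 1) * m := by exact_mod_cast hn
  have hr₁ : (0 : ℤ) < r + 1 := by positivity
  refine ⟨le_antisymm ?_ ?_, by linarith⟩
  · have : ((r : ℤ) + 1) * l < (r + 1) * (m - a + 1) := by linarith
    have := lt_of_mul_lt_mul_left this hr₁.le
    omega
  · have : ((r : ℤ) + 1) * (m - a) < (r + 1) * (l + 1) := by linarith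
    have := lt_of_mul_lt_mul_left this hr₁.le
    omega

/-- An optimal LRC with `(r+1) ∣ n` and `n/(r+1)` large enough admits `n/(r+1)` dual
codewords with pairwise disjoint supports of size exactly `r+1` covering all of `Fin n`. -/
theorem stmt_3 {F : Type*} [Field F] [Fintype F] [DecidableEq F] {n r k d : ℕ}
    (C : Submodule F (Fin n → F)) (hr : 0 < r)
    (hk : k = Module.finrank F ↥C) (hk1 : 1 ≤ k) (hd2 : 2 ≤ d)
    (hmd : IsMinDist C d) (hloc : HasLocality C r)
    (hopt : (d : ℤ) = (n : ℤ) - k - ⌈(k : ℚ) / (r : ℚ)⌉ + 2)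
    (hdvd : (r + 1) ∣ n)
    (hbig : ((n / (r + 1) : ℕ) : ℤ) ≥
      ((d : ℤ) - 2 - ⌊((d : ℚ) - 2) / ((r : ℚ) + 1)⌋) * (3 * r + 2) +
        ⌊((d : ℚ) - 2) / ((r : ℚ) + 1)⌋ + 1) :
    ∃ c : Fin (n / (r + 1)) → (Fin n → F),
      (∀ m, c m ∈ dualCode C ∧ c m ≠ 0 ∧ hammingNorm (c m) = r + 1) ∧
      (∀ m m', m ≠ m' →
        Disjoint (Function.support (c m)) (Function.support (c m'))) ∧
      (∀ j : Fin n, ∃ m, c m j ≠ 0) := by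
  classical
  have hn : n = (r + 1) * (n / (r + 1)) := (Nat.mul_div_cancel' hdvd).symm
  generalize n / (r + 1) = m at hn hbig ⊢
  obtain ⟨hl, hlk⟩ := optimal_parameters hr hn hopt
  generalize ⌈(k : ℚ) / (r : ℚ)⌉ = l at hl hlk hopt
  have ha0 : 0 ≤ ⌊((d : ℚ) - 2) / ((r : ℚ) + 1)⌋ := by
    have : (2 : ℚ) ≤ d := by exact_mod_cast hd2
    exact Int.floor_nonneg.2 (div_nonneg (by linarith) (by positivity))
  generalize ⌊((d : ℚ) - 2) / ((r : ℚ) + 1)⌋ = a at ha0 hl hbig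
  obtain ⟨B, hli, hB, hcov⟩ := hloc.exists_linearIndependent_cover
  let S : B → Finset (Fin n) := fun v => {i | v.1 i ≠ 0}
  have hS (v : B) : (S v).card ≤ r + 1 := (hB v v.2).2
  have hScov (i : Fin n) : ∃ v, i ∈ S v := by
    obtain ⟨v, hv, hvi⟩ := hcov i
    exact ⟨⟨v, hv⟩, by simpa [S] using hvi⟩
  have hdim := finrank_add_card_le_of_orthogonal C _ hli fun v => (hB v v.2).1
  obtain ⟨G, hG, hGcard⟩ := exists_isolated_of_cover S r hS hScov
  rw [Fintype.card_coe, Fintype.card_fin] at hdim hGcard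
  rw [← hk] at hdim
  have hBm : m ≤ B.card := by
    have h₁ : (Finset.univ.biUnion S).card ≤ (Finset.univ : Finset B).card * (r + 1) :=
      Finset.card_biUnion_le_card_mul _ _ _ fun v _ => hS v
    have h₂ : Finset.univ.biUnion S = Finset.univ := by
      ext i
      simpa using hScov i
    rw [h₂, Finset.card_univ, Finset.card_univ, Fintype.card_coe, Fintype.card_fin] at h₁
    exact Nat.le_of_mul_le_mul_left (by linarith) (Nat.succ_pos r)
  obtain ⟨e, he⟩ := Nat.exists_eq_add_of_le hBm
  lift a to ℕ using ha0
  have hn' : (n : ℤ) = (r + 1) * m := by exact_mod_cast hn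
  have hdim' : (k : ℤ) + (m + e) ≤ n := by exact_mod_cast he ▸ hdim
  have he' : (e : ℤ) ≤ d - 2 - a := by linarith
  obtain rfl | hepos := Nat.eq_zero_or_pos e
  · have hGuniv : G = Finset.univ := by
      refine (Finset.card_eq_iff_eq_univ G).1 (le_antisymm (Finset.card_le_univ G) ?_)
      rw [Fintype.card_coe]
      rw [he] at hGcard ⊢
      nlinarith
    have hall (v : B) := hG v (hGuniv ▸ Finset.mem_univ v)
    let φ : Fin m ≃ B := (Fintype.equivFinOfCardEq (by rw [Fintype.card_coe, he, add_zero])).symm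
    refine ⟨fun j => (φ j).1, fun j => ⟨(hB _ (φ j).2).1, ?_, (hall (φ j)).1⟩, ?_, ?_⟩
    · exact hli.ne_zero (φ j)
    · intro j j' hj
      have := (hall (φ j)).2 (φ j') (φ.injective.ne hj.symm)
      rw [← Finset.disjoint_coe] at this
      simpa [S, Function.support] using this
    · intro i
      obtain ⟨v, hv, hvi⟩ := hcov i
      exact ⟨φ.symm ⟨v, hv⟩, by simpa using hvi⟩
  · exfalso
    have hGae : a + e ≤ G.card := by
      have : ((a + e : ℕ) : ℤ) ≤ G.card := by
        rw [he] at hGcard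
        have : 2 * (n : ℤ) ≤ (2 * r + 1) * (m + e) + G.card := by exact_mod_cast hGcard
        push_cast
        nlinarith
      exact_mod_cast this
    obtain ⟨R, hRG, hR⟩ := Finset.exists_subset_card_eq hGae
    have hRdisj : (R.biUnion S).card = (a + e) * (r + 1) := by
      rw [Finset.card_biUnion fun v hv w _ hvw => (hG v (hRG hv)).2 w hvw.symm,
        Finset.sum_const_nat fun v hv => (hG v (hRG hv)).1, hR]
    have hoff : ∀ v : (Rᶜ : Finset B), ∀ x ∉ (R.biUnion S)ᶜ, v.1.1 x = 0 := by
      intro v x hx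
      simp only [Finset.mem_compl, Finset.mem_biUnion, not_not] at hx
      obtain ⟨w, hw, hxw⟩ := hx
      have hne : v.1 ≠ w := fun h => Finset.mem_compl.1 v.2 (h ▸ hw)
      have := Finset.disjoint_left.1 ((hG w (hRG hw)).2 v.1 hne) hxw
      simpa [S] using this
    have hUcard : ((R.biUnion S)ᶜ).card + (a + e) * (r + 1) = n := by
      rw [← hRdisj, Finset.card_compl_add_card, Fintype.card_fin]
    have hVcard : Fintype.card (Rᶜ : Finset B) + a = m := by
      have := Finset.card_compl_add_card R
      rw [Fintype.card_coe] at this ⊢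
      omega
    have hUcard' : (((R.biUnion S)ᶜ).card : ℤ) + (a + e) * (r + 1) = n := by
      exact_mod_cast hUcard
    have hVcard' : (Fintype.card (Rᶜ : Finset B) : ℤ) + a = m := by exact_mod_cast hVcard
    have hUle : ((R.biUnion S)ᶜ).card ≤ n + 1 - d := by
      have : (1 : ℤ) ≤ e := by exact_mod_cast hepos
      have : (((R.biUnion S)ᶜ).card : ℤ) + d ≤ n + 1 := by nlinarith
      omega
    obtain ⟨U, hsub, hU⟩ := Finset.exists_superset_card_eq hUle (by
      rw [Fintype.card_fin]; omega)
    obtain ⟨c, hc, hc0, hcU⟩ := exists_codeword_vanishing C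
      (fun v : (Rᶜ : Finset B) => v.1.1) (hli.comp _ Subtype.val_injective)
      (fun v => (hB v.1.1 v.1.2).1) U (fun v x hx => hoff v x fun h => hx (hsub h)) (by
        rw [← hk]; omega)
    have hle := hmd.2 ⟨c, hc, hc0, rfl⟩
    have hwt : hammingNorm c ≤ (Uᶜ).card := by
      refine Finset.card_le_card fun x hx => Finset.mem_compl.2 fun hxU => ?_
      exact (Finset.mem_filter.1 hx).2 (hcU x hxU)
    rw [Finset.card_compl, Fintype.card_fin] at hwt
    omega
end

section
/- Let C be an optimal LRC with locality r of length n over a finite field F with q = |F|, with dimension k ≥ 1 and minimum distance d ≥ 5, where (r+1) ∣ n and n/(r+1) ≥ (d - 2 - ⌊(d-2)/(r+1)⌋)·(3r+2) + ⌊(d-2)/(r+1)⌋ + 1. Let a ∈ {1,2} be such that d ≡ a (mod 4). Then, as real numbers, n ≤ ((r+1)/r) · ((d-a)/(4(q-1))) · q^(4(d-2)/(d-a)), where the exponent 4(d-2)/(d-a) is a real number. -/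
section

open Finset

/-- The number of words of Hamming weight `t`. -/
lemma card_hammingNorm_eq {ι F : Type*} [Fintype ι] [DecidableEq ι] [Field F] [Fintype F]
    [DecidableEq F] (t : ℕ) :
    #{e : ι → F | hammingNorm e = t} =
      (Fintype.card ι).choose t * (Fintype.card F - 1) ^ t := by
  have hmaps : ∀ e ∈ ({e : ι → F | hammingNorm e = t} : Finset (ι → F)),
      ({x | e x ≠ 0} : Finset ι) ∈ powersetCard t univ := by
    intro e he
    simpa [mem_powersetCard, hammingNorm] using he
  rw [card_eq_sum_card_fiberwise hmaps, ← card_univ, ← card_powersetCard, ← smul_eq_mul,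
    ← sum_const]
  refine sum_congr rfl fun T hT => ?_
  have hT' := (mem_powersetCard.mp hT).2
  have hfib : ({e ∈ ({e : ι → F | hammingNorm e = t} : Finset (ι → F)) |
      ({x | e x ≠ 0} : Finset ι) = T}) =
      Fintype.piFinset fun x => if x ∈ T then univ.erase (0 : F) else {0} := by
    ext e
    simp only [mem_filter, mem_univ, true_and, Fintype.mem_piFinset]
    constructor
    · rintro ⟨-, rfl⟩ x
      by_cases hx : e x = 0 <;> simp [hx]
    · intro h
      have hs : ({x | e x ≠ 0} : Finset ι) = T := by
        ext x
        have := h x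
        by_cases hx : x ∈ T <;> simp_all
      exact ⟨by rw [hammingNorm, hs, hT'], hs⟩
  rw [hfib, Fintype.card_piFinset, ← hT']
  simp only [apply_ite card, card_erase_of_mem (mem_univ (0 : F)), card_univ, card_singleton]
  rw [prod_ite_mem, univ_inter, prod_const]

/-- The sphere-packing bound, counting only the words at distance exactly `t`. -/
lemma card_mul_choose_mul_le {ι F : Type*} [Fintype ι] [DecidableEq ι] [Field F] [Fintype F]
    [DecidableEq F] (S : Finset (ι → F)) (t : ℕ)
    (h : ∀ a ∈ S, ∀ b ∈ S, a ≠ b → 2 * t < hammingDist a b) :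
    #S * ((Fintype.card ι).choose t * (Fintype.card F - 1) ^ t) ≤
      Fintype.card F ^ Fintype.card ι := by
  rw [← card_hammingNorm_eq, ← card_product, ← Fintype.card_fun, ← card_univ]
  refine card_le_card_of_injOn (fun p => p.1 + p.2) (fun _ _ => mem_univ _) ?_
  rintro ⟨a, e⟩ hae ⟨b, f⟩ hbf hab
  simp only [coe_product, Set.mem_prod, mem_coe, mem_filter, mem_univ, true_and] at hae hbf hab
  have hd : a = b := by
    by_contra hne
    have h1 := h a hae.1 b hbf.1 hne
    have h2 : hammingDist a b ≤ hammingDist f e := by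
      rw [hammingDist_eq_hammingNorm, hammingDist_eq_hammingNorm,
        show -a + b = -f + e by linear_combination -hab]
    have h3 := hammingDist_triangle f 0 e
    rw [hammingDist_zero_right, hammingDist_zero_left] at h3
    omega
  subst hd
  simpa using hab

lemma div_pow_le_choose {n t : ℕ} (ht : 0 < t) (h : t ≤ n) :
    ((n : ℝ) / t) ^ t ≤ n.choose t := by
  induction t, ht using Nat.le_induction generalizing n with
  | base => simp
  | succ t ht ih =>
    obtain ⟨n, rfl⟩ : ∃ m, n = m + 1 := ⟨n - 1, by omega⟩
    have htn : t ≤ n := by omega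
    have htn' : (t : ℝ) ≤ n := by exact_mod_cast htn
    have ht0 : (0 : ℝ) < t := by exact_mod_cast ht
    have hc : ((n + 1 : ℕ) : ℝ) * n.choose t = (n + 1).choose (t + 1) * ((t + 1 : ℕ) : ℝ) := by
      exact_mod_cast Nat.add_one_mul_choose_eq n t
    have hle : ((n + 1 : ℕ) : ℝ) / (t + 1 : ℕ) ≤ n / t := by
      push_cast
      rw [div_le_div_iff₀ (by positivity) ht0]
      linarith
    calc (((n + 1 : ℕ) : ℝ) / (t + 1 : ℕ)) ^ (t + 1)
        = (((n + 1 : ℕ) : ℝ) / (t + 1 : ℕ)) ^ t * (((n + 1 : ℕ) : ℝ) / (t + 1 : ℕ)) :=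
          pow_succ _ _
      _ ≤ n.choose t * (((n + 1 : ℕ) : ℝ) / (t + 1 : ℕ)) := by
          gcongr
          exact (pow_le_pow_left₀ (by positivity) hle t).trans (ih htn)
      _ = (n + 1).choose (t + 1) := by
          rw [mul_div_assoc', mul_comm, hc, mul_div_cancel_right₀]
          positivity

/-- Dual words supported in `S`, each owning a private coordinate, bound the dimension of a code
that is determined by its restriction to `S`. -/
lemma finrank_add_card_le {F α : Type*} [Field F] {n : ℕ} {C : Submodule F (Fin n → F)}
    {J : Finset α} {v : α → Fin n → F} {p : α → Fin n} {S : Finset (Fin n)}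
    (hv : ∀ i ∈ J, v i ∈ dualCode C) (hp : ∀ i ∈ J, v i (p i) ≠ 0)
    (hpriv : ∀ i ∈ J, ∀ j ∈ J, j ≠ i → v j (p i) = 0)
    (hS : ∀ i ∈ J, ∀ y, v i y ≠ 0 → y ∈ S)
    (hinj : ∀ c ∈ C, (∀ y ∈ S, c y = 0) → c = 0) :
    Module.finrank F C + #J ≤ #S := by
  classical
  have hpinj : Set.InjOn p J := by
    intro i hi j hj hij
    by_contra hne
    exact hp i hi (hij ▸ hpriv j hj i hi hne)
  have hsub : J.image p ⊆ S := by
    intro y hy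
    obtain ⟨i, hi, rfl⟩ := mem_image.mp hy
    exact hS i hi _ (hp i hi)
  let T := S \ J.image p
  let f : C →ₗ[F] (T → F) := (LinearMap.funLeft F F (Subtype.val : T → Fin n)).comp C.subtype
  have hf : Function.Injective f := by
    rw [injective_iff_map_eq_zero]
    rintro ⟨c, hc⟩ h0
    have hT : ∀ y ∈ T, c y = 0 := fun y hy => congrFun h0 ⟨y, hy⟩
    refine Subtype.ext (hinj c hc fun y hy => ?_)
    by_cases hyp : y ∈ J.image p
    · obtain ⟨i, hi, rfl⟩ := mem_image.mp hyp
      have hdot := hv i hi c hc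
      rw [sum_eq_single (p i)] at hdot
      · exact (mul_eq_zero.mp hdot).resolve_left (hp i hi)
      · intro z _ hz
        by_cases hvz : v i z = 0
        · rw [hvz, zero_mul]
        · have hzT : z ∈ T := by
            refine mem_sdiff.mpr ⟨hS i hi z hvz, fun hzp => ?_⟩
            obtain ⟨j, hj, rfl⟩ := mem_image.mp hzp
            exact hvz (hpriv j hj i hi fun hij => hz (by rw [hij]))
          rw [hT z hzT, mul_zero]
      · simp
    · exact hT y (mem_sdiff.mpr ⟨hy, hyp⟩)
  have h1 := LinearMap.finrank_le_finrank_of_injective hf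
  rw [Module.finrank_fintype_fun_eq_card, Fintype.card_coe, card_sdiff_of_subset hsub,
    card_image_of_injOn hpinj] at h1
  have h2 := card_le_card hsub
  rw [card_image_of_injOn hpinj] at h2
  omega

/-- In a cover by sets of size at most `b`, the number of sets that are either smaller than `b` or
meet another set of the cover is at most twice the total overlap. -/
lemma card_overlapping_add_le {α β : Type*} [DecidableEq α] [Fintype β] [DecidableEq β]
    (I : Finset α) (R : α → Finset β) (b : ℕ) (hR : ∀ i ∈ I, #(R i) ≤ b)
    (hcov : ∀ x, ∃ i ∈ I, x ∈ R i) :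
    #{i ∈ I | ¬ (#(R i) = b ∧ ∀ j ∈ I, j ≠ i → Disjoint (R i) (R j))} + 2 * Fintype.card β ≤
      2 * b * #I := by
  let mult : β → ℕ := fun x => #{i ∈ I | x ∈ R i}
  have hcount : ∀ P : β → Prop, ∀ [DecidablePred P],
      ∑ i ∈ I, #{x ∈ R i | P x} = ∑ x, if P x then mult x else 0 := by
    intro P _
    have h1 : ∀ i ∈ I, #{x ∈ R i | P x} = ∑ x, if P x ∧ x ∈ R i then 1 else 0 := by
      intro i _
      rw [← card_filter]
      congr 1
      ext x
      simp [and_comm]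
    rw [sum_congr rfl h1, sum_comm]
    refine sum_congr rfl fun x _ => ?_
    by_cases hx : P x <;> simp [hx, mult]
  have htot : ∑ i ∈ I, #(R i) = ∑ x, mult x := by
    simpa using hcount fun _ => True
  have hset : ∀ i ∈ I,
      (if ¬ (#(R i) = b ∧ ∀ j ∈ I, j ≠ i → Disjoint (R i) (R j)) then 1 else 0) + 2 * #(R i) ≤
        2 * b + #{x ∈ R i | 2 ≤ mult x} := by
    intro i hi
    have hRi := hR i hi
    split_ifs with hbad
    · omega
    · by_cases hb : #(R i) = b
      · have hpos : 0 < #{x ∈ R i | 2 ≤ mult x} := by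
          have : ∃ j ∈ I, j ≠ i ∧ ¬ Disjoint (R i) (R j) := by
            by_contra hno
            push Not at hno
            exact hbad ⟨hb, hno⟩
          obtain ⟨j, hj, hji, hd⟩ := this
          obtain ⟨x, hxi, hxj⟩ := not_disjoint_iff.mp hd
          refine card_pos.mpr ⟨x, mem_filter.mpr ⟨hxi, ?_⟩⟩
          exact one_lt_card.mpr ⟨i, by simp [hi, hxi], j, by simp [hj, hxj], hji.symm⟩
        omega
      · omega
  have hsum := sum_le_sum hset
  rw [sum_add_distrib, sum_add_distrib, ← card_filter, hcount, ← mul_sum, htot, sum_const,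
    smul_eq_mul] at hsum
  have hpt : ∀ x ∈ (univ : Finset β), (if 2 ≤ mult x then mult x else 0) + 2 ≤ 2 * mult x := by
    intro x _
    have : 0 < mult x := by
      obtain ⟨i, hi, hx⟩ := hcov x
      exact card_pos.mpr ⟨i, by simp [hi, hx]⟩
    split_ifs <;> omega
  have hpt' := sum_le_sum hpt
  rw [sum_add_distrib, ← mul_sum, sum_const, card_univ, smul_eq_mul] at hpt'
  have hcomm : #I * (2 * b) = 2 * b * #I := mul_comm _ _
  omega

/-- A code with locality `r` has dual words of weight at most `r + 1` that cover all coordinates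
and each own a private coordinate. -/
lemma HasLocality.exists_irredundant {F : Type*} [Field F] [DecidableEq F] {n : ℕ}
    {C : Submodule F (Fin n → F)} {r : ℕ} (h : HasLocality C r) :
    ∃ (I : Finset (Fin n)) (v : Fin n → Fin n → F) (p : Fin n → Fin n),
      (∀ i, v i ∈ dualCode C) ∧ (∀ i, hammingNorm (v i) ≤ r + 1) ∧
      (∀ x, ∃ i ∈ I, v i x ≠ 0) ∧ (∀ i ∈ I, v i (p i) ≠ 0) ∧
      ∀ i ∈ I, ∀ j ∈ I, j ≠ i → v j (p i) = 0 := by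
  choose v hv hvi hw using h
  obtain ⟨I, hI⟩ := exists_minimal (s := ({I | ∀ x, ∃ i ∈ I, v i x ≠ 0} :
    Finset (Finset (Fin n)))) ⟨univ, by simpa using fun x => ⟨x, hvi x⟩⟩
  have hcov : ∀ x, ∃ i ∈ I, v i x ≠ 0 := by simpa using hI.prop
  have hpriv : ∀ i, ∃ x, i ∈ I → v i x ≠ 0 ∧ ∀ j ∈ I, j ≠ i → v j x = 0 := by
    intro i
    by_cases hi : i ∈ I
    · by_contra hno
      push Not at hno
      have hmem : I.erase i ∈ ({I | ∀ x, ∃ i ∈ I, v i x ≠ 0} : Finset (Finset (Fin n))) := by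
        simp only [mem_filter, mem_univ, true_and]
        intro x
        obtain ⟨j, hj, hjx⟩ := hcov x
        by_cases hji : j = i
        · obtain ⟨l, hl, hli, hlx⟩ := (hno x).2 (hji ▸ hjx)
          exact ⟨l, mem_erase.mpr ⟨hli, hl⟩, hlx⟩
        · exact ⟨j, mem_erase.mpr ⟨hji, hj⟩, hjx⟩
      exact notMem_erase i I (hI.le_of_le hmem (erase_subset i I) hi)
    · exact ⟨i, fun h => absurd h hi⟩
  choose p hp using hpriv
  exact ⟨I, v, p, hv, hw, hcov, fun i hi => (hp i hi).1, fun i hi => (hp i hi).2⟩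

/-- If the number `ℓ` of blocks is large compared with `D = d - 2 - u`, an optimal code of length
`(r + 1) * ℓ` has `ℓ` pairwise disjointly supported dual words of weight at most `r + 1`. -/
lemma exists_disjoint_dual_words {F : Type*} [Field F] [DecidableEq F] {n r ℓ s u d D : ℕ}
    {C : Submodule F (Fin n → F)} (hloc : HasLocality C r)
    (hmin : ∀ c ∈ C, c ≠ 0 → d ≤ hammingNorm c) (hn : n = (r + 1) * ℓ) (hsu : s + u = ℓ)
    (hopt : d + Module.finrank F C + s = n + 2) (hu : d ≤ (r + 1) * (u + 1) + 1)
    (hD : D + u + 2 = d) (hbig : D * (2 * (r + 1)) + u ≤ ℓ) (hdn : d ≤ n) :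
    ∃ (I : Finset (Fin n)) (v : Fin n → Fin n → F) (p : Fin n → Fin n),
      #I = ℓ ∧ (∀ i, v i ∈ dualCode C) ∧ (∀ i ∈ I, v i (p i) ≠ 0) ∧
      ∀ i ∈ I, ∀ j ∈ I, j ≠ i → ∀ x, v i x ≠ 0 → v j x = 0 := by
  obtain ⟨I, v, p, hv, hw, hcov, hp, hpriv⟩ := hloc.exists_irredundant
  let R : Fin n → Finset (Fin n) := fun i => {x | v i x ≠ 0}
  have hR : ∀ i, #(R i) ≤ r + 1 := hw
  have hmemR : ∀ i x, x ∈ R i ↔ v i x ≠ 0 := fun i x => by simp [R]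
  have hcovR : ∀ x, ∃ i ∈ I, x ∈ R i := by simpa only [hmemR] using hcov
  let G := {i ∈ I | #(R i) = r + 1 ∧ ∀ j ∈ I, j ≠ i → Disjoint (R i) (R j)}
  let B := {i ∈ I | ¬ (#(R i) = r + 1 ∧ ∀ j ∈ I, j ≠ i → Disjoint (R i) (R j))}
  have hsplit : #G + #B = #I := card_filter_add_card_filter_not _
  have hbad : #B + 2 * ((r + 1) * ℓ) ≤ 2 * (r + 1) * #I := by
    have h := card_overlapping_add_le I R (r + 1) (fun i _ => hR i) hcovR
    rw [Fintype.card_fin] at h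
    rw [← hn]
    convert h
  have hle : ℓ ≤ #I := by
    have : (r + 1) * ℓ ≤ (r + 1) * #I := by
      rw [← hn, mul_comm, ← smul_eq_mul]
      calc n = #(univ : Finset (Fin n)) := by simp
        _ ≤ #(I.biUnion R) := card_le_card fun x _ => mem_biUnion.mpr (hcovR x)
        _ ≤ #I • (r + 1) := card_biUnion_le_card_mul _ _ _ fun i _ => hR i
    exact Nat.le_of_mul_le_mul_left this (Nat.succ_pos r)
  have hup : Module.finrank F C + #I ≤ n := by
    have := finrank_add_card_le (C := C) (J := I) (S := univ) (fun i _ => hv i) hp hpriv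
      (fun _ _ _ _ => mem_univ _) (fun c _ h => funext fun y => h y (mem_univ y))
    simpa using this
  have hIeq : #I = ℓ := by
    by_contra hne
    obtain ⟨e, he⟩ := Nat.exists_eq_add_of_le hle
    have heD : e ≤ D := by omega
    have he1 : 1 ≤ e := by omega
    have hGcard : e + u ≤ #G := by
      have h1 : e * (2 * (r + 1)) ≤ D * (2 * (r + 1)) := Nat.mul_le_mul_right _ heD
      have h2 : #B ≤ e * (2 * (r + 1)) := by
        rw [he] at hbad
        linarith
      omega
    obtain ⟨P, hPG, hPcard⟩ := exists_subset_card_eq hGcard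
    have hPI : P ⊆ I := hPG.trans (filter_subset _ _)
    have hPgood : ∀ i ∈ P, #(R i) = r + 1 ∧ ∀ j ∈ I, j ≠ i → Disjoint (R i) (R j) :=
      fun i hi => (mem_filter.mp (hPG hi)).2
    have hJcard : #(I \ P) = s := by
      rw [card_sdiff_of_subset hPI]
      omega
    have hU : #(P.biUnion R) = (e + u) * (r + 1) := by
      rw [card_biUnion fun i hi j hj hij => (hPgood i hi).2 j (hPI hj) hij.symm,
        sum_congr rfl fun i hi => (hPgood i hi).1, sum_const, hPcard, smul_eq_mul]
    have hS0 : #(P.biUnion R)ᶜ ≤ n - d + 1 := by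
      rw [card_compl, hU, Fintype.card_fin]
      have : (1 + u) * (r + 1) ≤ (e + u) * (r + 1) := by gcongr
      have : (r + 1) * (u + 1) = (1 + u) * (r + 1) := by ring
      omega
    obtain ⟨S, hSsub, -, hScard⟩ := exists_subsuperset_card_eq (subset_univ _) hS0
      (by rw [card_univ, Fintype.card_fin]; omega)
    have := finrank_add_card_le (C := C) (J := I \ P) (v := v) (p := p) (S := S)
      (fun i _ => hv i) (fun i hi => hp i (mem_sdiff.mp hi).1)
      (fun i hi j hj => hpriv i (mem_sdiff.mp hi).1 j (mem_sdiff.mp hj).1)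
      (fun i hi y hy => by
        refine hSsub (mem_compl.mpr fun hyU => ?_)
        obtain ⟨j, hj, hyj⟩ := mem_biUnion.mp hyU
        have hij : i ≠ j := fun h => (mem_sdiff.mp hi).2 (h ▸ hj)
        exact disjoint_left.mp ((hPgood j hj).2 i (mem_sdiff.mp hi).1 hij) hyj
          ((hmemR i y).mpr hy))
      (fun c hc h0 => by
        by_contra hc0
        have h1 := hmin c hc hc0
        have h2 : hammingNorm c ≤ #Sᶜ := card_le_card fun y hy =>
          mem_compl.mpr fun hyS => (mem_filter.mp hy).2 (h0 y hyS)
        rw [card_compl, Fintype.card_fin] at h2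
        omega)
    omega
  have hB0 : B = ∅ := by
    rw [← card_eq_zero]
    rw [hIeq] at hbad
    linarith
  refine ⟨I, v, p, hIeq, hv, hp, fun i hi j hj hji x hx => ?_⟩
  have hgood : #(R i) = r + 1 ∧ ∀ j ∈ I, j ≠ i → Disjoint (R i) (R j) := by
    by_contra hno
    have : i ∈ B := mem_filter.mpr ⟨hi, hno⟩
    simp [hB0] at this
  by_contra hjx
  exact disjoint_left.mp (hgood.2 j hj hji) ((hmemR i x).mpr hx) ((hmemR j x).mpr hjx)

/-- Deleting one coordinate from the support of each of several disjointly supported dual words at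
most halves the weight of a codeword. -/
lemma hammingNorm_le_two_mul_restrict {F : Type*} [Field F] [DecidableEq F] {n : ℕ}
    {C : Submodule F (Fin n → F)} {I : Finset (Fin n)} {v : Fin n → Fin n → F}
    {p : Fin n → Fin n} (hv : ∀ i, v i ∈ dualCode C) (hp : ∀ i ∈ I, v i (p i) ≠ 0)
    (hdisj : ∀ i ∈ I, ∀ j ∈ I, j ≠ i → ∀ x, v i x ≠ 0 → v j x = 0)
    {c : Fin n → F} (hc : c ∈ C) :
    hammingNorm c ≤ 2 * hammingNorm fun x : ((I.image p)ᶜ : Finset (Fin n)) => c x := by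
  have hex : ∀ i, ∃ y, i ∈ I → c (p i) ≠ 0 → v i y ≠ 0 ∧ c y ≠ 0 ∧ y ≠ p i := by
    intro i
    by_contra hno
    push Not at hno
    obtain ⟨hi, hci, -⟩ := hno i
    have hdot := hv i c hc
    rw [sum_eq_single (p i)] at hdot
    · exact mul_ne_zero (hp i hi) hci hdot
    · intro y _ hy
      by_contra hne
      obtain ⟨h1, h2⟩ := mul_ne_zero_iff.mp hne
      exact hy ((hno y).2.2 h1 h2)
    · simp
  choose g hg using hex
  have hrestrict : hammingNorm (fun x : ((I.image p)ᶜ : Finset (Fin n)) => c x) =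
      #{x ∈ (I.image p)ᶜ | c x ≠ 0} := by
    rw [hammingNorm, ← card_map (Function.Embedding.subtype _)]
    congr 1
    ext x
    simp [and_comm]
  have hrep : #{x ∈ I.image p | c x ≠ 0} ≤ #{x ∈ (I.image p)ᶜ | c x ≠ 0} := by
    have h1 : #{x ∈ I.image p | c x ≠ 0} ≤ #{i ∈ I | c (p i) ≠ 0} := by
      rw [filter_image]
      exact card_image_le
    refine h1.trans (card_le_card_of_injOn g ?_ ?_)
    · intro i hi
      obtain ⟨hi, hci⟩ := mem_filter.mp hi
      obtain ⟨hvg, hcg, hgp⟩ := hg i hi hci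
      refine mem_filter.mpr ⟨mem_compl.mpr fun hmem => ?_, hcg⟩
      obtain ⟨j, hj, hjg⟩ := mem_image.mp hmem
      by_cases hji : j = i
      · exact hgp (by rw [← hjg, hji])
      · exact hp j hj (hjg ▸ hdisj i hi j hj hji _ hvg)
    · intro i hi j hj hij
      obtain ⟨hi, hci⟩ := mem_filter.mp hi
      obtain ⟨hj, hcj⟩ := mem_filter.mp hj
      by_contra hne
      refine (hg j hj hcj).1 ?_
      rw [← hij]
      exact hdisj i hi j hj (Ne.symm hne) _ (hg i hi hci).1
  have htotal : hammingNorm c =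
      #{x ∈ I.image p | c x ≠ 0} + #{x ∈ (I.image p)ᶜ | c x ≠ 0} := by
    rw [← card_union_of_disjoint (disjoint_filter_filter disjoint_compl_right), ← filter_union,
      union_compl, hammingNorm]
  omega

/-- The packing inequality for the code punctured at one coordinate per dual word. -/
lemma choose_mul_pow_le {F : Type*} [Field F] [Fintype F] [DecidableEq F] {n d t : ℕ}
    {C : Submodule F (Fin n → F)} (hmin : ∀ c ∈ C, c ≠ 0 → d ≤ hammingNorm c) (ht : 4 * t < d)
    {I : Finset (Fin n)} {v : Fin n → Fin n → F} {p : Fin n → Fin n}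
    (hv : ∀ i, v i ∈ dualCode C) (hp : ∀ i ∈ I, v i (p i) ≠ 0)
    (hdisj : ∀ i ∈ I, ∀ j ∈ I, j ≠ i → ∀ x, v i x ≠ 0 → v j x = 0) :
    Fintype.card F ^ Module.finrank F C *
        ((n - #I).choose t * (Fintype.card F - 1) ^ t) ≤ Fintype.card F ^ (n - #I) := by
  have hpinj : Set.InjOn p I := by
    intro i hi j hj hij
    by_contra hne
    exact hp j hj (hij ▸ hdisj i hi j hj (Ne.symm hne) _ (hp i hi))
  let f : (Fin n → F) →ₗ[F] (((I.image p)ᶜ : Finset (Fin n)) → F) :=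
    LinearMap.funLeft F F Subtype.val
  have hdist : ∀ a ∈ C, ∀ b ∈ C, a ≠ b → 2 * t < hammingDist (f a) (f b) := by
    intro a ha b hb hab
    have h1 := hmin (-a + b) (C.add_mem (C.neg_mem ha) hb)
      (by rwa [Ne, neg_add_eq_zero])
    have h2 := hammingNorm_le_two_mul_restrict hv hp hdisj (C.add_mem (C.neg_mem ha) hb)
    have h3 : hammingDist (f a) (f b) =
        hammingNorm fun x : ((I.image p)ᶜ : Finset (Fin n)) => (-a + b) x := by
      rw [hammingDist_eq_hammingNorm]
      rfl
    omega
  have hinj : Set.InjOn f (C : Set (Fin n → F)) := by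
    intro a ha b hb hab
    by_contra hne
    have := hdist a ha b hb hne
    rw [hab, hammingDist_self] at this
    omega
  classical
  have hcard : #((univ.filter fun c => c ∈ C).image f) =
      Fintype.card F ^ Module.finrank F C := by
    rw [card_image_of_injOn (by simpa using hinj), ← Fintype.card_subtype]
    exact Module.card_eq_pow_finrank
  have hlen : Fintype.card ((I.image p)ᶜ : Finset (Fin n)) = n - #I := by
    rw [Fintype.card_coe, card_compl, card_image_of_injOn hpinj, Fintype.card_fin]
  rw [← hcard, ← hlen]
  refine card_mul_choose_mul_le _ t ?_
  simp only [mem_image, mem_filter, mem_univ, true_and]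
  rintro _ ⟨a, ha, rfl⟩ _ ⟨b, hb, rfl⟩ hab
  exact hdist a ha b hb fun h => hab (by rw [h])

end

/-- Upper bound on the length of an optimal LRC when `d ≡ a (mod 4)` with `a ∈ {1,2}`:
`n ≤ ((r+1)/r) · ((d-a)/(4(q-1))) · q^{4(d-2)/(d-a)}`. -/
theorem stmt_4 {F : Type*} [Field F] [Fintype F] [DecidableEq F] {n r k d a : ℕ}
    (C : Submodule F (Fin n → F)) (hr : 0 < r)
    (hk : k = Module.finrank F ↥C) (hk1 : 1 ≤ k) (hd5 : 5 ≤ d)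
    (hmd : IsMinDist C d) (hloc : HasLocality C r)
    (hopt : (d : ℤ) = (n : ℤ) - k - ⌈(k : ℚ) / (r : ℚ)⌉ + 2)
    (hdvd : (r + 1) ∣ n)
    (hbig : ((n / (r + 1) : ℕ) : ℤ) ≥
      ((d : ℤ) - 2 - ⌊((d : ℚ) - 2) / ((r : ℚ) + 1)⌋) * (3 * r + 2) +
        ⌊((d : ℚ) - 2) / ((r : ℚ) + 1)⌋ + 1)
    (ha : a = 1 ∨ a = 2) (hmod : d % 4 = a % 4) :
    (n : ℝ) ≤ ((r : ℝ) + 1) / (r : ℝ) *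
      (((d : ℝ) - (a : ℝ)) / (4 * ((Fintype.card F : ℝ) - 1))) *
      (Fintype.card F : ℝ) ^ (4 * ((d : ℝ) - 2) / ((d : ℝ) - (a : ℝ))) := by
  have hrQ : (0 : ℚ) < r := by exact_mod_cast hr
  obtain ⟨c₀, -, -, hc₀⟩ := hmd.1
  have hdn : d ≤ n := by
    have : hammingNorm c₀ ≤ Fintype.card (Fin n) := hammingNorm_le_card_fintype
    rwa [hc₀, Fintype.card_fin] at this
  have hmin : ∀ c ∈ C, c ≠ 0 → d ≤ hammingNorm c := fun c hc h0 => hmd.2 ⟨c, hc, h0, rfl⟩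
  obtain ⟨ℓ, hn⟩ := hdvd
  rw [hn, Nat.mul_div_cancel_left _ (Nat.succ_pos r)] at hbig
  obtain ⟨s, hs⟩ := Int.eq_ofNat_of_zero_le
    (Int.ceil_nonneg (by positivity : (0 : ℚ) ≤ (k : ℚ) / r))
  have hd2 : (0 : ℚ) ≤ (d : ℚ) - 2 := by
    have : (5 : ℚ) ≤ d := by exact_mod_cast hd5
    linarith
  obtain ⟨u, hu⟩ := Int.eq_ofNat_of_zero_le
    (Int.floor_nonneg.mpr (by positivity : (0 : ℚ) ≤ ((d : ℚ) - 2) / ((r : ℚ) + 1)))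
  obtain ⟨hs1, hs2⟩ := Int.ceil_eq_iff.mp hs
  obtain ⟨hu1, hu2⟩ := Int.floor_eq_iff.mp hu
  rw [hs] at hopt
  rw [hu] at hbig
  rw [lt_div_iff₀ hrQ] at hs1
  rw [div_le_iff₀ hrQ] at hs2
  rw [le_div_iff₀ (by positivity)] at hu1
  rw [div_lt_iff₀ (by positivity)] at hu2
  have hs1' : ((s : ℤ) - 1) * r < k := by exact_mod_cast hs1
  have hs2' : (k : ℤ) ≤ s * r := by exact_mod_cast hs2
  have hu1' : (u : ℤ) * (r + 1) ≤ d - 2 := by exact_mod_cast hu1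
  have hu2' : (d : ℤ) - 2 < (u + 1) * (r + 1) := by exact_mod_cast hu2
  have hnZ : (n : ℤ) = (r + 1) * ℓ := by exact_mod_cast hn
  have hr1 : (0 : ℤ) < r + 1 := by positivity
  have hsu : s + u = ℓ := by
    have h1 : (ℓ : ℤ) - s < u + 1 := by
      refine lt_of_mul_lt_mul_right ?_ hr1.le
      linarith
    have h2 : (u : ℤ) < ℓ - s + 1 := by
      refine lt_of_mul_lt_mul_right ?_ hr1.le
      linarith
    omega
  have hud : (u : ℤ) ≤ d - 2 := by nlinarith
  obtain ⟨D, hD⟩ : ∃ D, D + u + 2 = d := ⟨d - 2 - u, by omega⟩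
  have hbig' : D * (2 * (r + 1)) + u ≤ ℓ := by
    have hDZ : (d : ℤ) - 2 - u = D := by omega
    rw [hDZ] at hbig
    have : (0 : ℤ) ≤ D * r := by positivity
    zify
    linarith
  have hoptN : d + Module.finrank F C + s = n + 2 := by
    rw [← hk]
    omega
  have huN : d ≤ (r + 1) * (u + 1) + 1 := by
    zify
    linarith
  obtain ⟨I, v, p, hI, hv, hp, hdisj⟩ :=
    exists_disjoint_dual_words hloc hmin hn hsu hoptN huN hD hbig' hdn
  obtain ⟨t, ht⟩ : ∃ t, d = 4 * t + a := ⟨d / 4, by omega⟩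
  have ht0 : 0 < t := by omega
  have hpack := choose_mul_pow_le hmin (t := t) (by omega) hv hp hdisj
  have hlen : n - I.card = r * ℓ := by
    rw [hI, hn, add_mul, one_mul, Nat.add_sub_cancel]
  have hlen' : n - I.card = Module.finrank F C + D := by omega
  have hq : 2 ≤ Fintype.card F := Fintype.one_lt_card
  have hchoose : (r * ℓ).choose t * (Fintype.card F - 1) ^ t ≤ Fintype.card F ^ (d - 2) := by
    nth_rewrite 2 [hlen'] at hpack
    rw [pow_add, hlen] at hpack
    exact (Nat.le_of_mul_le_mul_left hpack (by positivity)).trans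
      (Nat.pow_le_pow_right (by omega) (by omega))
  have htlen : t ≤ r * ℓ := by
    have : ℓ ≤ r * ℓ := Nat.le_mul_of_pos_left ℓ hr
    have : n = r * ℓ + ℓ := by rw [hn]; ring
    omega
  set q := Fintype.card F
  have hq1 : (0 : ℝ) < (q : ℝ) - 1 := by
    have : (2 : ℝ) ≤ q := by exact_mod_cast hq
    linarith
  have hrR : (0 : ℝ) < r := by exact_mod_cast hr
  have htR : (0 : ℝ) < t := by exact_mod_cast ht0
  have hda : (d : ℝ) - a = 4 * t := by
    rw [ht]
    push_cast
    ring
  have hreal : ((r * ℓ : ℕ) : ℝ) / t * ((q : ℝ) - 1) ≤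
      (q : ℝ) ^ (4 * ((d : ℝ) - 2) / ((d : ℝ) - (a : ℝ))) := by
    refine (pow_le_pow_iff_left₀ (by positivity) (by positivity) ht0.ne').mp ?_
    have hexp : 4 * ((d : ℝ) - 2) / ((d : ℝ) - a) * t = ((d - 2 : ℕ) : ℝ) := by
      rw [hda, Nat.cast_sub (by omega)]
      push_cast
      field_simp
    rw [← Real.rpow_mul_natCast (by positivity), hexp, Real.rpow_natCast, mul_pow]
    calc (((r * ℓ : ℕ) : ℝ) / t) ^ t * ((q : ℝ) - 1) ^ t
        ≤ (r * ℓ).choose t * ((q : ℝ) - 1) ^ t := by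
          gcongr
          exact div_pow_le_choose ht0 htlen
      _ = (((r * ℓ).choose t * (q - 1) ^ t : ℕ) : ℝ) := by
          rw [Nat.cast_mul, Nat.cast_pow, Nat.cast_sub (by omega), Nat.cast_one]
      _ ≤ (q : ℝ) ^ (d - 2) := by exact_mod_cast hchoose
  calc (n : ℝ) = ((r : ℝ) + 1) / r * ((4 * t) / (4 * ((q : ℝ) - 1))) *
        (((r * ℓ : ℕ) : ℝ) / t * ((q : ℝ) - 1)) := by
          rw [hn]
          push_cast
          field_simp
    _ ≤ _ := by
          rw [hda] at hreal ⊢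
          gcongr
end

section
/- Let C be an optimal LRC with locality r of length n over a finite field F with q = |F|, with dimension k ≥ 1 and minimum distance exactly 5, where (r+1) ∣ n and n/(r+1) ≥ (3 - ⌊3/(r+1)⌋)·(3r+2) + ⌊3/(r+1)⌋ + 1. Then, as real numbers, n ≤ ((r+1)/r) · q³/(q-1). In particular, the length of an optimal LRC of minimum distance 5 is O(q²). -/
/-- A cover of a type by finitely many sets `{x | R j x}` has a subcover in which every
member `j` covers some point `p j` covered by no other member. -/
theorem exists_irredundant_cover {ι α : Type*} [Fintype ι] [DecidableEq ι] (R : ι → α → Prop)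
    (hR : ∀ x, ∃ j, R j x) :
    ∃ (T : Finset ι) (p : T → α), (∀ x, ∃ j : T, R j x) ∧ ∀ i j : T, R i (p j) ↔ i = j := by
  obtain ⟨T, hT⟩ := exists_minimal_of_wellFoundedLT
    (fun T : Finset ι ↦ ∀ x, ∃ j ∈ T, R j x) ⟨Finset.univ, fun x ↦ by simpa using hR x⟩
  have key : ∀ j : T, ∃ x, ∀ i : T, R i x ↔ i = j := by
    rintro ⟨j, hj⟩
    by_contra! h
    refine Finset.notMem_erase j T (hT.le_of_le (y := T.erase j) (fun x ↦ ?_)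
      (Finset.erase_subset j T) hj)
    by_contra! hx
    have hne : ∀ i ∈ T, R i x → i = j := fun i hi hix ↦ by
      by_contra hij
      exact hx i (Finset.mem_erase.2 ⟨hij, hi⟩) hix
    obtain ⟨i, hi, hix⟩ := hT.prop x
    obtain ⟨⟨i', hi'⟩, h'⟩ := h x
    have hjx : R j x := hne i hi hix ▸ hix
    rcases h' with ⟨h1, h2⟩ | ⟨h1, h2⟩
    · exact h2 (Subtype.ext (hne i' hi' h1))
    · exact h1 (by rw [h2]; exact hjx)
  choose p hp using key
  exact ⟨T, p, fun x ↦ by simpa using hT.prop x, fun i j ↦ hp j i⟩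

/-- Double counting of incidences in a cover by sets of size at most `s`: many points are
covered exactly once. -/
theorem two_mul_card_le_of_cover {ι α : Type*} [Fintype ι] [DecidableEq ι] [Fintype α]
    [DecidableEq α] (R : ι → α → Prop) [∀ i x, Decidable (R i x)] (p : ι → α) {s : ℕ}
    (hcov : ∀ x, ∃ j, R j x) (hs : ∀ j, (Finset.univ.filter (R j)).card ≤ s) :
    Fintype.card α ≤ Fintype.card ι * s ∧
    2 * Fintype.card α ≤ Nat.card {x // (∀ j, p j ≠ x) ∧ ∃! j, R j x} +
      Fintype.card ι * (s + 1) := by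
  classical
  have hsum : ∑ x, (Finset.univ.filter (R · x)).card ≤ Fintype.card ι * s := by
    calc ∑ x, (Finset.univ.filter (R · x)).card
        = ∑ j, (Finset.univ.filter (R j)).card :=
          (Finset.sum_card_bipartiteAbove_eq_sum_card_bipartiteBelow R).symm
      _ ≤ Fintype.card ι * s := by
          simpa using Finset.sum_le_card_nsmul Finset.univ _ s fun j _ ↦ hs j
  have hpos : ∀ x, 1 ≤ (Finset.univ.filter (R · x)).card := fun x ↦ by
    obtain ⟨j, hj⟩ := hcov x
    exact Finset.card_pos.2 ⟨j, by simpa using hj⟩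
  have htwo : ∀ x, 2 ≤ (Finset.univ.filter (R · x)).card + if ∃! j, R j x then 1 else 0 := by
    intro x
    split_ifs with h
    · have := hpos x
      omega
    · by_contra! hlt
      have h1 : (Finset.univ.filter (R · x)).card = 1 := by
        have := hpos x
        omega
      obtain ⟨j, hj⟩ := Finset.card_eq_one.1 h1
      refine h ⟨j, ?_, fun i hi ↦ ?_⟩
      · simpa using (Finset.ext_iff.1 hj j).2 (by simp)
      · simpa using (Finset.ext_iff.1 hj i).1 (by simpa using hi)
  have h1 := Finset.sum_le_sum fun x (_ : x ∈ Finset.univ) ↦ hpos x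
  have h2 := Finset.sum_le_sum fun x (_ : x ∈ Finset.univ) ↦ htwo x
  rw [Finset.sum_add_distrib, Finset.sum_boole] at h2
  have hU : (Finset.univ.filter fun x ↦ ∃! j, R j x).card ≤
      Nat.card {x // (∀ j, p j ≠ x) ∧ ∃! j, R j x} + Fintype.card ι := by
    rw [Nat.card_eq_fintype_card, Fintype.card_subtype]
    calc (Finset.univ.filter fun x ↦ ∃! j, R j x).card
        ≤ ((Finset.univ.filter fun x ↦ (∀ j, p j ≠ x) ∧ ∃! j, R j x) ∪
            Finset.univ.image p).card := by
          refine Finset.card_le_card fun x hx ↦ ?_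
          by_cases h : ∃ j, p j = x
          · simp [h]
          · have h' : ∀ j, p j ≠ x := not_exists.1 h
            simp only [Finset.mem_filter, Finset.mem_univ, true_and] at hx
            exact Finset.mem_union_left _ (by simpa using ⟨h', hx⟩)
      _ ≤ _ := (Finset.card_union_le _ _).trans (Nat.add_le_add_left Finset.card_image_le _)
  simp at h1 h2
  constructor
  · omega
  · rw [mul_add]
    omega

/-- A finite family of dual codewords `v i`, each with a private coordinate `p i`, leaves
`n - |ι| - k` further parity checks, and these separate, up to scaling, the weight-two words on
coordinates lying in a single support. -/
theorem card_syndromes_le {F : Type*} [Field F] [Fintype F] [DecidableEq F] {n : ℕ}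
    (C : Submodule F (Fin n → F)) (hC : ∀ c ∈ C, hammingNorm c ≤ 4 → c = 0)
    {ι : Type*} [Fintype ι] [DecidableEq ι] (v : ι → Fin n → F) (hv : ∀ i, v i ∈ dualCode C)
    (p : ι → Fin n) (hp : ∀ i j, v i (p j) ≠ 0 ↔ i = j) :
    ∃ u, Fintype.card ι + u + Module.finrank F C = n ∧
      Nat.card {x // (∀ j, p j ≠ x) ∧ ∃! j, v j x ≠ 0} * (Fintype.card F - 1) <
        Fintype.card F ^ u := by
  classical
  have hp0 : ∀ i j, i ≠ j → v i (p j) = 0 := fun i j h ↦ by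
    by_contra h'
    exact h ((hp i j).1 h')
  have hpp : ∀ i, v i (p i) ≠ 0 := fun i ↦ (hp i i).2 rfl
  let L : (Fin n → F) →ₗ[F] ι → F := Matrix.mulVecLin (Matrix.of v)
  have hL : ∀ x i, L x i = ∑ a, v i a * x a := fun x i ↦ rfl
  have hsurj : Function.Surjective L := by
    intro y
    refine ⟨∑ j, (y j / v j (p j)) • Pi.single (p j) (1 : F), funext fun i ↦ ?_⟩
    have hs : ∀ j, L (Pi.single (p j) 1) i = v i (p j) := fun j ↦ by
      simp [hL, Pi.single_apply]
    simp only [map_sum, map_smul, Finset.sum_apply, Pi.smul_apply, hs, smul_eq_mul]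
    rw [Finset.sum_eq_single i (fun j _ hj ↦ by simp [hp0 i j hj.symm]) (by simp)]
    exact div_mul_cancel₀ _ (hpp i)
  have hCL : C ≤ LinearMap.ker L := fun c hc ↦ by
    rw [LinearMap.mem_ker]
    exact funext fun i ↦ hv i c hc
  let K := C.comap (LinearMap.ker L).subtype
  refine ⟨Module.finrank F (LinearMap.ker L ⧸ K), ?_, ?_⟩
  · have h1 := L.finrank_range_add_finrank_ker
    rw [LinearMap.range_eq_top.2 hsurj, finrank_top] at h1
    have h2 := K.finrank_quotient_add_finrank
    rw [(Submodule.comapSubtypeEquivOfLe hCL).finrank_eq] at h2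
    simp at h1
    omega
  · let X := {x // (∀ j, p j ≠ x) ∧ ∃! j, v j x ≠ 0}
    have hX : ∀ x : X, ∃ j, v j x ≠ 0 ∧ ∀ i, i ≠ j → v i x = 0 := fun x ↦ by
      obtain ⟨j, hj, hj'⟩ := x.2.2
      exact ⟨j, hj, fun i hi ↦ by_contra fun h ↦ hi (hj' i h)⟩
    choose g hg hg' using hX
    let y : X → Fin n → F := fun x ↦
      v (g x) (p (g x)) • Pi.single x.1 1 - v (g x) x • Pi.single (p (g x)) 1
    have hyx : ∀ x, y x x = v (g x) (p (g x)) := fun x ↦ by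
      simp [y, (x.2.1 (g x)).symm]
    have hyx' : ∀ x z : X, x ≠ z → y z x = 0 := fun x z h ↦ by
      have : (x : Fin n) ≠ z := fun h' ↦ h (Subtype.ext h')
      simp [y, (x.2.1 (g z)).symm, this]
    have hsupp : ∀ x a, y x a ≠ 0 → a ∈ ({x.1, p (g x)} : Finset (Fin n)) := by
      intro x a ha
      by_contra h
      simp only [Finset.mem_insert, Finset.mem_singleton, not_or] at h
      exact ha (by simp [y, h.1, h.2])
    have hyL : ∀ x, y x ∈ LinearMap.ker L := fun x ↦ by
      rw [LinearMap.mem_ker]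
      refine funext fun i ↦ ?_
      have : L (y x) i = v (g x) (p (g x)) * v i x - v (g x) x * v i (p (g x)) := by
        have hs : ∀ a, L (Pi.single a 1) i = v i a := fun a ↦ by
          simp [hL, Pi.single_apply]
        simp only [y, map_sub, map_smul, Pi.sub_apply, Pi.smul_apply, hs, smul_eq_mul]
      rw [this]
      by_cases h : i = g x
      · subst h
        simp [mul_comm]
      · simp [hg' x i h, hp0 i _ h]
    have hdiff : ∀ (c d : F) (x z : X), c • y x - d • y z ∈ C → c • y x - d • y z = 0 := by
      intro c d x z h
      refine hC _ h ?_
      calc hammingNorm (c • y x - d • y z)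
          ≤ (({x.1, p (g x)} : Finset (Fin n)) ∪ {z.1, p (g z)}).card := by
            refine Finset.card_le_card fun a ha ↦ ?_
            by_contra h'
            rw [Finset.mem_union, not_or] at h'
            have h1 : y x a = 0 := by_contra fun h ↦ h'.1 (hsupp x a h)
            have h2 : y z a = 0 := by_contra fun h ↦ h'.2 (hsupp z a h)
            simp [h1, h2] at ha
        _ ≤ 2 + 2 := (Finset.card_union_le _ _).trans
            (Nat.add_le_add Finset.card_le_two Finset.card_le_two)
    have hcoord : ∀ (c d : F) (x z : X), c • y x - d • y z ∈ C → c ≠ 0 → x = z ∧ c = d := by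
      intro c d x z h hc
      have h0 := congrFun (hdiff c d x z h) x
      simp only [Pi.sub_apply, Pi.smul_apply, smul_eq_mul, Pi.zero_apply] at h0
      by_cases hxz : x = z
      · subst hxz
        rw [← sub_mul, hyx] at h0
        exact ⟨rfl, sub_eq_zero.1 ((mul_eq_zero.1 h0).resolve_right (hpp _))⟩
      · rw [hyx' x z hxz, hyx, mul_zero, sub_zero] at h0
        exact absurd h0 (mul_ne_zero hc (hpp _))
    let f : X × Fˣ → LinearMap.ker L ⧸ K := fun a ↦
      K.mkQ ((a.2 : F) • ⟨y a.1, hyL a.1⟩)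
    have hf : Function.Injective f := by
      rintro ⟨x, c⟩ ⟨z, d⟩ h
      have h' : (c : F) • y x - (d : F) • y z ∈ C := (Submodule.Quotient.eq K).1 h
      obtain ⟨h1, h2⟩ := hcoord _ _ _ _ h' c.ne_zero
      exact Prod.ext h1 (Units.ext h2)
    have hf0 : (0 : LinearMap.ker L ⧸ K) ∉ Set.range f := by
      rintro ⟨⟨x, c⟩, h⟩
      have h' : (c : F) • y x ∈ C := (Submodule.Quotient.mk_eq_zero K).1 h
      exact c.ne_zero (hcoord c 0 x x (by simpa using h') c.ne_zero).2
    have : Fintype (LinearMap.ker L ⧸ K) := Fintype.ofFinite _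
    have hlt := Fintype.card_lt_of_injective_of_notMem f hf hf0
    rw [Fintype.card_prod, Fintype.card_units, ← Nat.card_eq_fintype_card (α := X)] at hlt
    calc _ < _ := hlt
      _ = _ := by
        rw [← Nat.card_eq_fintype_card, Module.natCard_eq_pow_finrank (K := F),
          Nat.card_eq_fintype_card]

/-- The arithmetic behind the length bound: `m` is the number of repair groups if these are
disjoint, `t` is the number of local parity checks used, `u` is the number of remaining parity
checks, and `X` counts the weight-two words separated by them. -/
theorem groups_mul_le {m r t u k q X : ℕ} (hr : 0 < r) (hq : 2 ≤ q) (hm : 6 * r + 6 ≤ m)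
    (hk : m * r ≤ k + 3) (htu : t + u + k = (r + 1) * m) (hcov : (r + 1) * m ≤ t * (r + 1))
    (hX : 2 * ((r + 1) * m) ≤ X + t * (r + 1 + 1)) (hXu : X * (q - 1) < q ^ u) :
    m * r * (q - 1) ≤ q ^ 3 := by
  obtain ⟨a, rfl⟩ := Nat.exists_eq_add_of_le (Nat.le_of_mul_le_mul_right (mul_comm (r + 1) m ▸ hcov) (by omega))
  obtain ⟨s, rfl⟩ := Nat.exists_eq_add_of_le hq
  have hau : a + u ≤ 3 := by linarith
  have hX' : m * r ≤ X + a * (r + 2) := by linarith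
  have hmr : (6 * r + 6) * r ≤ m * r := Nat.mul_le_mul_right r hm
  have hpow : (2 + s) ^ u ≤ (2 + s) ^ (3 - a) := Nat.pow_le_pow_right (by omega) (by omega)
  rw [show 2 + s - 1 = s + 1 by omega] at *
  have ha : a ≤ 3 := by omega
  interval_cases a
  · simp at hX' hpow
    calc m * r * (s + 1) ≤ X * (s + 1) := Nat.mul_le_mul_right _ hX'
      _ ≤ _ := by omega
  · simp at hX' hpow
    have hXs : X ≤ s + 3 := by
      by_contra! h
      nlinarith
    have hs : r + 2 ≤ s + 2 := by nlinarith
    have : m * r ≤ s + r + 5 := by omega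
    nlinarith
  · simp at hX' hpow
    have : X ≤ 1 := by
      by_contra! h
      nlinarith
    nlinarith
  · simp at hX' hpow
    have : X = 0 := by
      by_contra h
      have : 1 ≤ X := by omega
      nlinarith
    nlinarith

/-- Upper bound for optimal LRCs of minimum distance exactly `5`:
`n ≤ ((r+1)/r) · q³/(q-1)`; in particular `n = O(q²)`. -/
theorem stmt_6 {F : Type*} [Field F] [Fintype F] [DecidableEq F] {n r k : ℕ}
    (C : Submodule F (Fin n → F)) (hr : 0 < r)
    (hk : k = Module.finrank F ↥C) (hk1 : 1 ≤ k)
    (hmd : IsMinDist C 5) (hloc : HasLocality C r)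
    (hopt : (5 : ℤ) = (n : ℤ) - k - ⌈(k : ℚ) / (r : ℚ)⌉ + 2)
    (hdvd : (r + 1) ∣ n)
    (hbig : ((n / (r + 1) : ℕ) : ℤ) ≥
      ((3 : ℤ) - ⌊(3 : ℚ) / ((r : ℚ) + 1)⌋) * (3 * r + 2) +
        ⌊(3 : ℚ) / ((r : ℚ) + 1)⌋ + 1) :
    (n : ℝ) ≤ ((r : ℝ) + 1) / (r : ℝ) *
      (Fintype.card F : ℝ) ^ 3 / ((Fintype.card F : ℝ) - 1) := by
  obtain ⟨m, rfl⟩ := hdvd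
  have hm : 6 * r + 6 ≤ m := by
    rw [Nat.mul_div_cancel_left _ (by omega : 0 < r + 1)] at hbig
    have hr' : (1 : ℚ) ≤ r := by exact_mod_cast hr
    have h0 : (0 : ℤ) ≤ ⌊(3 : ℚ) / ((r : ℚ) + 1)⌋ := Int.floor_nonneg.2 (by positivity)
    have h1 : ⌊(3 : ℚ) / ((r : ℚ) + 1)⌋ < 2 := by
      rw [Int.floor_lt, div_lt_iff₀ (by positivity)]
      push_cast
      linarith
    have hr'' : (1 : ℤ) ≤ r := by exact_mod_cast hr
    generalize ⌊(3 : ℚ) / ((r : ℚ) + 1)⌋ = e at *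
    have : e ≤ 1 := by omega
    have : (6 * r + 6 : ℤ) ≤ m := by nlinarith
    exact_mod_cast this
  have hkm : m * r ≤ k + 3 := by
    by_contra! h
    have hr' : (0 : ℚ) < r := by exact_mod_cast hr
    have hceil : ⌈(k : ℚ) / (r : ℚ)⌉ ≤ (m : ℤ) := by
      rw [Int.ceil_le, div_le_iff₀ hr']
      have : k ≤ m * r := by omega
      exact_mod_cast this
    have h' : (k : ℤ) + 3 < m * r := by exact_mod_cast h
    push_cast at hopt
    linarith
  choose w hw hwi hwr using hloc
  obtain ⟨T, p, hcov, hp⟩ := exists_irredundant_cover (fun i x ↦ w i x ≠ 0) fun x ↦ ⟨x, hwi x⟩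
  have hC : ∀ c ∈ C, hammingNorm c ≤ 4 → c = 0 := fun c hc h ↦ by
    by_contra hc0
    have := hmd.2 ⟨c, hc, hc0, rfl⟩
    omega
  obtain ⟨u, hu, hXu⟩ := card_syndromes_le C hC (fun j : T ↦ w j) (fun j ↦ hw j) p hp
  obtain ⟨h1, h2⟩ := two_mul_card_le_of_cover (fun (j : T) x ↦ w j x ≠ 0) p hcov
    fun j ↦ hwr j
  rw [Fintype.card_fin] at h1 h2
  rw [← hk] at hu
  have hq : 2 ≤ Fintype.card F := Fintype.one_lt_card
  have main := groups_mul_le hr hq hm hkm hu h1 h2 hXu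
  have hq' : (0 : ℝ) < (Fintype.card F : ℝ) - 1 := by
    have : (2 : ℝ) ≤ Fintype.card F := by exact_mod_cast hq
    linarith
  have hr' : (0 : ℝ) < r := by exact_mod_cast hr
  have main' : (m : ℝ) * r * ((Fintype.card F : ℝ) - 1) ≤ (Fintype.card F : ℝ) ^ 3 := by
    have := (Nat.cast_le (α := ℝ)).2 main
    rwa [Nat.cast_mul, Nat.cast_mul, Nat.cast_pow, Nat.cast_sub (by omega), Nat.cast_one] at this
  rw [le_div_iff₀ hq', div_mul_eq_mul_div, le_div_iff₀ hr']
  push_cast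
  calc _ = ((r : ℝ) + 1) * (m * r * ((Fintype.card F : ℝ) - 1)) := by ring
    _ ≤ _ := mul_le_mul_of_nonneg_left main' (by positivity)
end

section
/- Let F be a field, let ℓ, r, h ≥ 1 and d ≥ 2 be integers, and let v : Fin ℓ × Fin (r+1) → (Fin h → F) be a family of vectors. For (i,j) ∈ Fin ℓ × Fin (r+1), define H(i,j) ∈ (Fin ℓ → F) × (Fin h → F) by H(i,j) = (Pi.single i 1, v(i,j)) (i.e., the first block is the i-th standard basis vector of F^ℓ and the second block is v(i,j)). Suppose that every subfamily of at most d-1 distinct vectors H(i,j) is linearly independent over F. Then the family of vectors w(i,j) := v(i,j) - v(i, last), indexed by (i,j) ∈ Fin ℓ × Fin r (where 'last' denotes the last element of Fin (r+1)), has the property that every subfamily of at most ⌊(d-1)/2⌋ distinct vectors w(i,j) is linearly independent over F. -/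
/-- If every `d-1` of the columns `H(i,j) = (e_i, v(i,j))` are linearly independent, then
every `⌊(d-1)/2⌋` of the differences `w(i,j) = v(i,j) - v(i, last)` are linearly
independent. -/
theorem stmt_7 {F : Type*} [Field F] {ℓ r h d : ℕ} (hℓ : 1 ≤ ℓ) (hr : 1 ≤ r)
    (hh : 1 ≤ h) (hd : 2 ≤ d)
    (v : Fin ℓ × Fin (r + 1) → (Fin h → F))
    (H : Fin ℓ × Fin (r + 1) → (Fin ℓ → F) × (Fin h → F))
    (hH : ∀ p, H p = (Pi.single p.1 (1 : F), v p))
    (hind : ∀ s : Finset (Fin ℓ × Fin (r + 1)), s.card ≤ d - 1 →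
      LinearIndependent F (fun p : {x // x ∈ s} => H p.1)) :
    ∀ s : Finset (Fin ℓ × Fin r), s.card ≤ (d - 1) / 2 →
      LinearIndependent F
        (fun p : {x // x ∈ s} =>
          v (p.1.1, Fin.castSucc p.1.2) - v (p.1.1, Fin.last r)) := by
  classical
  intro s hs
  let a : Fin ℓ × Fin r → Fin ℓ × Fin (r + 1) := fun p => (p.1, Fin.castSucc p.2)
  let b : Fin ℓ × Fin r → Fin ℓ × Fin (r + 1) := fun p => (p.1, Fin.last r)
  let t : Finset (Fin ℓ × Fin (r + 1)) := s.image a ∪ s.image b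
  have ht : t.card ≤ d - 1 := by
    have h1 := Finset.card_union_le (s.image a) (s.image b)
    have h2 := Finset.card_image_le (s := s) (f := a)
    have h3 := Finset.card_image_le (s := s) (f := b)
    simp only [t]
    omega
  have hat : ∀ p ∈ s, a p ∈ t := fun p hp =>
    Finset.mem_union_left _ (Finset.mem_image_of_mem a hp)
  have hbt : ∀ p ∈ s, b p ∈ t := fun p hp =>
    Finset.mem_union_right _ (Finset.mem_image_of_mem b hp)
  have hlin : LinearIndepOn F H (t : Set (Fin ℓ × Fin (r + 1))) := hind t ht
  change LinearIndepOn F (fun p => v (a p) - v (b p)) (s : Set (Fin ℓ × Fin r))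
  rw [linearIndepOn_finset_iff] at hlin ⊢
  intro g hg q hq
  let f : Fin ℓ × Fin (r + 1) → F := fun x =>
    ∑ p ∈ s, g p * ((if x = a p then 1 else 0) - if x = b p then 1 else 0)
  have hf : ∑ x ∈ t, f x • H x = 0 := by
    calc
      ∑ x ∈ t, f x • H x = ∑ p ∈ s, g p • (H (a p) - H (b p)) := by
        simp only [f, Finset.sum_smul]
        rw [Finset.sum_comm]
        refine Finset.sum_congr rfl fun p hp => ?_
        simp only [mul_smul, sub_smul, ite_smul, one_smul, zero_smul, ← Finset.smul_sum,
          Finset.sum_sub_distrib, Finset.sum_ite_eq', hat p hp, hbt p hp, if_true]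
      _ = ∑ p ∈ s, LinearMap.inr F (Fin ℓ → F) (Fin h → F) (g p • (v (a p) - v (b p))) := by
        refine Finset.sum_congr rfl fun p _ => ?_
        simp [hH, a, b]
      _ = 0 := by rw [← map_sum, hg, map_zero]
  have hfq : f (a q) = g q := by
    have hab : ∀ p, a q ≠ b p := fun p hp =>
      (Fin.castSucc_lt_last q.2).ne (congrArg Prod.snd hp)
    have haa : ∀ p, a q = a p ↔ q = p := fun p => by
      simp [a, Prod.ext_iff]
    simp [f, hab, haa, hq]
  rw [← hfq]
  exact hlin f hf (a q) (hat q hq)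
end

section
/- Let d and r be integers with 5 ≤ d ≤ r + 2. Then there exists a real constant η > 0, depending only on d and r, such that for every finite field F with q = |F| and every positive integer n with (r+1) ∣ n, q(r+1) < n, and (as real numbers) n ≤ η · q^(1 + 1/⌊(d-3)/2⌋), there exists a linear code C of length n over F such that: (i) C has locality r; (ii) the dimension k = Module.finrank F C satisfies k ≥ n - n/(r+1) - (d-2); (iii) every nonzero codeword of C has Hamming weight at least d; (iv) if d - 2 < r, every nonzero codeword of C has Hamming weight at least n - k - ⌈k/r⌉ + 2, and if d - 2 = r, every nonzero codeword of C has Hamming weight at least n - k - ⌈k/r⌉ + 1 (with ⌈·⌉ the ceiling of the rational k/r). -/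
/-- `U` together with all blocks `A j`, `j ∈ J`, that meet `U`. -/
def expand {V ι : Type*} [DecidableEq V] (A : ι → Finset V) (J : Finset ι) (U : Finset V) :
    Finset V :=
  U ∪ (J.filter fun j => ¬ Disjoint (A j) U).biUnion A

section Expand

variable {V ι : Type*} [DecidableEq V] {A : ι → Finset V} {J : Finset ι}

lemma mem_expand {U : Finset V} {y : V} :
    y ∈ expand A J U ↔ y ∈ U ∨ ∃ j ∈ J, y ∈ A j ∧ ∃ x ∈ A j, x ∈ U := by
  simp only [expand, Finset.mem_union, Finset.mem_biUnion, Finset.mem_filter,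
    Finset.not_disjoint_iff]
  grind

lemma subset_expand (U : Finset V) : U ⊆ expand A J U :=
  Finset.subset_union_left

lemma expand_mono : Monotone (expand A J) := by
  intro U W h y
  simp only [mem_expand]
  grind

lemma iterate_expand_subset_of_le {k l : ℕ} (h : k ≤ l) (U : Finset V) :
    (expand A J)^[k] U ⊆ (expand A J)^[l] U :=
  Function.monotone_iterate_of_id_le (fun U => subset_expand U) h U

lemma disjoint_expand_comm (U W : Finset V) :
    Disjoint (expand A J U) W ↔ Disjoint U (expand A J W) := by
  simp only [Finset.disjoint_left, mem_expand]
  grind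

lemma disjoint_iterate_expand_comm (k : ℕ) (U W : Finset V) :
    Disjoint ((expand A J)^[k] U) W ↔ Disjoint U ((expand A J)^[k] W) := by
  induction k generalizing U W with
  | zero => rfl
  | succ k ih =>
    rw [Function.iterate_succ_apply, ih, disjoint_expand_comm,
      ← Function.iterate_succ_apply' (expand A J)]

lemma mem_iterate_expand_singleton_comm (k : ℕ) (x y : V) :
    x ∈ (expand A J)^[k] {y} ↔ y ∈ (expand A J)^[k] {x} := by
  have h := disjoint_iterate_expand_comm (A := A) (J := J) k {y} {x}
  rw [Finset.disjoint_singleton_right, Finset.disjoint_singleton_left] at h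
  exact not_iff_not.mp h

lemma card_expand_le {D s : ℕ} (hs : ∀ j ∈ J, (A j).card ≤ s)
    (hD : ∀ x, (J.filter fun j => x ∈ A j).card ≤ D) (U : Finset V) :
    (expand A J U).card ≤ (D * s + 1) * U.card := by
  have hsub : expand A J U ⊆ U ∪ U.biUnion fun x => (J.filter fun j => x ∈ A j).biUnion A := by
    intro y
    simp only [mem_expand, Finset.mem_union, Finset.mem_biUnion, Finset.mem_filter]
    grind
  calc (expand A J U).card
      ≤ U.card + (U.biUnion fun x => (J.filter fun j => x ∈ A j).biUnion A).card :=
        (Finset.card_le_card hsub).trans (Finset.card_union_le _ _)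
    _ ≤ U.card + U.card * (D * s) := by
        gcongr
        refine Finset.card_biUnion_le_card_mul _ _ _ fun x _ => ?_
        refine (Finset.card_biUnion_le_card_mul _ _ s fun j hj =>
          hs j (Finset.mem_filter.mp hj).1).trans ?_
        gcongr
        exact hD x
    _ = (D * s + 1) * U.card := by ring

lemma card_iterate_expand_le {D s : ℕ} (hs : ∀ j ∈ J, (A j).card ≤ s)
    (hD : ∀ x, (J.filter fun j => x ∈ A j).card ≤ D) (k : ℕ) (U : Finset V) :
    ((expand A J)^[k] U).card ≤ (D * s + 1) ^ k * U.card := by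
  induction k with
  | zero => simp
  | succ k ih =>
    rw [Function.iterate_succ_apply', pow_succ']
    calc _ ≤ (D * s + 1) * _ := card_expand_le hs hD _
      _ ≤ (D * s + 1) * ((D * s + 1) ^ k * U.card) := by gcongr
      _ = _ := by ring

/-- Any set of points is contained in a union of connected components of the blocks in `T`,
reached by at most `T.card` expansion steps. -/
lemma exists_closed_subset_iterate_expand [DecidableEq ι] {T : Finset ι} (hT : T ⊆ J)
    (U : Finset V) :
    ∃ K, U ⊆ K ∧ K ⊆ (expand A J)^[T.card] U ∧ ∀ b ∈ T, Disjoint (A b) K ∨ A b ⊆ K := by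
  induction hk : T.card generalizing T U with
  | zero => exact ⟨U, by simp, by simp, by simp [Finset.card_eq_zero.mp hk]⟩
  | succ k ih =>
    by_cases hU : ∀ b ∈ T, Disjoint (A b) U
    · exact ⟨U, subset_rfl, iterate_expand_subset_of_le (Nat.zero_le _) U,
        fun b hb => .inl (hU b hb)⟩
    · push Not at hU
      obtain ⟨b, hb, hbU⟩ := hU
      obtain ⟨K, hUK, hK, hcl⟩ := ih (T := T.erase b) ((T.erase_subset b).trans hT) (U ∪ A b)
        (by rw [Finset.card_erase_of_mem hb, hk, Nat.add_sub_cancel])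
      refine ⟨K, Finset.subset_union_left.trans hUK, ?_, fun b' hb' => ?_⟩
      · rw [Function.iterate_succ_apply]
        refine hK.trans (expand_mono.iterate k ?_)
        refine Finset.union_subset (subset_expand U) fun y hy => mem_expand.mpr (.inr ?_)
        obtain ⟨x, hx, hxU⟩ := Finset.not_disjoint_iff.mp hbU
        exact ⟨b, hT hb, hy, x, hx, hxU⟩
      · by_cases h : b' = b
        · exact .inr (h ▸ Finset.subset_union_right.trans hUK)
        · exact hcl b' (Finset.mem_erase.mpr ⟨h, hb'⟩)

end Expand

/-- If every point is related to at most `N` others, one can choose greedily `s` pairwise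
unrelated points. -/
lemma exists_card_eq_pairwise_not {V : Type*} [DecidableEq V] (P : Finset V)
    (B : V → Finset V) (hself : ∀ x, x ∈ B x) {N s : ℕ} (hB : ∀ x, (B x).card ≤ N)
    (hsymm : ∀ x y, x ∈ B y ↔ y ∈ B x) (h : (s - 1) * N < P.card) (hs : 0 < s) :
    ∃ S ⊆ P, S.card = s ∧ ∀ x ∈ S, ∀ y ∈ S, x ≠ y → y ∉ B x := by
  obtain ⟨s, rfl⟩ : ∃ k, s = k + 1 := ⟨s - 1, by omega⟩
  rw [Nat.add_sub_cancel] at h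
  clear hs
  have key : ∀ j ≤ s + 1, ∃ S ⊆ P, S.card = j ∧ ∀ x ∈ S, ∀ y ∈ S, x ≠ y → y ∉ B x := by
    intro j
    induction j with
    | zero => exact fun _ => ⟨∅, by simp⟩
    | succ j ih =>
      intro hj
      obtain ⟨S, hSP, hS, hSB⟩ := ih (by omega)
      have hlt : (S.biUnion B).card < P.card :=
        calc (S.biUnion B).card ≤ S.card * N :=
              Finset.card_biUnion_le_card_mul _ _ _ fun x _ => hB x
          _ ≤ s * N := by gcongr; omega
          _ < P.card := h
      obtain ⟨z, hzP, hz⟩ := Finset.exists_mem_notMem_of_card_lt_card hlt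
      simp only [Finset.mem_biUnion, not_exists, not_and] at hz
      have hzS : z ∉ S := fun hzS => hz z hzS (hself z)
      refine ⟨insert z S, Finset.insert_subset hzP hSP,
        by rw [Finset.card_insert_of_notMem hzS, hS], ?_⟩
      grind
  exact key (s + 1) le_rfl

/-- Greedy construction of a family of `m` blocks of size `r + 1` in which any two points of a block
are far apart with respect to the earlier blocks. -/
lemma exists_blocks_far_apart (V : Type*) [Fintype V] [DecidableEq V] {r t D M : ℕ}
    (hM : 2 * (M * (r + 1)) ≤ D * Fintype.card V)
    (hD : 2 * (r * (D * (r + 1) + 1) ^ t) < Fintype.card V) :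
    ∃ A : ℕ → Finset V, (∀ i < M, (A i).card = r + 1) ∧
      ∀ i < M, ∀ x ∈ A i, ∀ y ∈ A i, x ≠ y → y ∉ (expand A (Finset.range i))^[t] {x} := by
  have key : ∀ m ≤ M, ∃ A : ℕ → Finset V, (∀ i < m, (A i).card = r + 1) ∧
      (∀ x, ((Finset.range m).filter fun j => x ∈ A j).card ≤ D) ∧
      ∀ i < m, ∀ x ∈ A i, ∀ y ∈ A i, x ≠ y → y ∉ (expand A (Finset.range i))^[t] {x} := by
    intro m
    induction m with
    | zero => exact fun _ => ⟨fun _ => ∅, by simp⟩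
    | succ m ih =>
      intro hm
      obtain ⟨A, hA, hdeg, hfar⟩ := ih (by omega)
      set deg : V → ℕ := fun x => ((Finset.range m).filter fun j => x ∈ A j).card with hdegdef
      set P := Finset.univ.filter fun x => deg x < D with hP
      have hsum : ∑ x, deg x = m * (r + 1) := by
        simp only [hdegdef, Finset.card_filter]
        rw [Finset.sum_comm]
        simp only [← Finset.card_filter, Finset.filter_univ_mem]
        rw [Finset.sum_congr rfl fun i hi => hA i (Finset.mem_range.mp hi)]
        simp
      have hsat : 2 * (Finset.univ.filter fun x => ¬ deg x < D).card ≤ Fintype.card V := by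
        have h1 : (Finset.univ.filter fun x => ¬ deg x < D).card * D ≤ m * (r + 1) := by
          rw [← hsum, ← smul_eq_mul]
          refine (Finset.card_nsmul_le_sum _ deg D fun x hx => ?_).trans
            (Finset.sum_le_sum_of_subset (Finset.filter_subset _ _))
          simpa using hx
        have hDpos : 0 < D := by
          rcases Nat.eq_zero_or_pos D with rfl | h
          · have : 0 < M * (r + 1) := Nat.mul_pos (by omega) (by omega)
            omega
          · exact h
        have h2 : m * (r + 1) ≤ M * (r + 1) := Nat.mul_le_mul_right _ (by omega)
        nlinarith
      have hPcard : Fintype.card V ≤ 2 * P.card := by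
        have := Finset.card_filter_add_card_filter_not (s := (Finset.univ : Finset V))
          (fun x => deg x < D)
        rw [Finset.card_univ] at this
        rw [hP]
        omega
      obtain ⟨S, hSP, hS, hSfar⟩ := exists_card_eq_pairwise_not P
        (fun x => (expand A (Finset.range m))^[t] {x})
        (fun x => iterate_expand_subset_of_le (Nat.zero_le t) _ (Finset.mem_singleton_self x))
        (N := (D * (r + 1) + 1) ^ t) (s := r + 1)
        (fun x => by
          simpa using card_iterate_expand_le
            (fun j hj => (hA j (Finset.mem_range.mp hj)).le) hdeg t {x})
        (fun x y => mem_iterate_expand_singleton_comm t x y)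
        (by rw [Nat.add_sub_cancel]; omega) (Nat.succ_pos r)
      have hlt : ∀ i < m, Function.update A m S i = A i := fun i hi =>
        Function.update_of_ne hi.ne _ _
      have hexp : ∀ i ≤ m, expand (Function.update A m S) (Finset.range i) =
          expand A (Finset.range i) := by
        intro i hi
        ext U y
        simp only [mem_expand, Finset.mem_range]
        grind
      refine ⟨Function.update A m S, fun i hi => ?_, fun x => ?_, fun i hi => ?_⟩
      · rcases Nat.lt_succ_iff_lt_or_eq.mp hi with h | rfl
        · rw [hlt i h, hA i h]
        · rw [Function.update_self, hS]
      · have hfil : ((Finset.range m).filter fun j => x ∈ Function.update A m S j) =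
            (Finset.range m).filter fun j => x ∈ A j :=
          Finset.filter_congr fun j hj => by rw [hlt j (Finset.mem_range.mp hj)]
        rw [Finset.range_add_one, Finset.filter_insert, hfil, Function.update_self]
        split_ifs with hx
        · exact (Finset.card_insert_le _ _).trans (Finset.mem_filter.mp (hSP hx)).2
        · exact hdeg x
      · rw [hexp i (by omega)]
        rcases Nat.lt_succ_iff_lt_or_eq.mp hi with h | rfl
        · rw [hlt i h]
          exact hfar i h
        · rw [Function.update_self]
          exact hSfar
  obtain ⟨A, hA, -, hfar⟩ := key M le_rfl
  exact ⟨A, hA, hfar⟩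

/-- If the moments of order less than `e` of a weight supported on at most `e` indices vanish, then
so does its total weight at every point. -/
lemma sum_fiber_eq_zero_of_moments {F ι : Type*} [Field F] [DecidableEq F] [Fintype ι]
    {c pos : ι → F} {e : ℕ} (hc : hammingNorm c ≤ e)
    (hmom : ∀ j < e, ∑ i, c i * pos i ^ j = 0) (x : F) :
    ∑ i with pos i = x, c i = 0 := by
  classical
  set X := (Finset.univ.filter fun i => c i ≠ 0).image pos
  by_cases hx : x ∈ X
  · set p : Polynomial F := ∏ y ∈ X.erase x, (Polynomial.X - Polynomial.C y) with hp
    have hcard : X.card ≤ e := Finset.card_image_le.trans hc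
    have hdeg : p.natDegree < e := by
      rw [hp, Polynomial.natDegree_finsetProd_X_sub_C_eq_card, Finset.card_erase_of_mem hx]
      have := Finset.card_pos.mpr ⟨x, hx⟩
      omega
    have hzero : ∑ i, c i * p.eval (pos i) = 0 := by
      simp only [Polynomial.eval_eq_sum_range' hdeg, Finset.mul_sum]
      rw [Finset.sum_comm]
      refine Finset.sum_eq_zero fun j hj => ?_
      rw [← mul_zero (p.coeff j), ← hmom j (Finset.mem_range.mp hj), Finset.mul_sum]
      exact Finset.sum_congr rfl fun i _ => by ring
    have hne : p.eval x ≠ 0 := by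
      rw [hp, Polynomial.eval_prod, Finset.prod_ne_zero_iff]
      intro y hy
      simpa [sub_eq_zero] using (Finset.ne_of_mem_erase hy).symm
    have hsplit : ∑ i, c i * p.eval (pos i) = (∑ i with pos i = x, c i) * p.eval x := by
      rw [Finset.sum_mul, Finset.sum_filter]
      refine Finset.sum_congr rfl fun i _ => ?_
      split_ifs with h
      · rw [h]
      · by_cases hci : c i = 0
        · rw [hci, zero_mul]
        · have hmem : pos i ∈ X.erase x := Finset.mem_erase.mpr
            ⟨h, Finset.mem_image_of_mem _ (by simpa using hci)⟩
          rw [hp, Polynomial.eval_prod, Finset.prod_eq_zero hmem (by simp), mul_zero]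
    exact (mul_eq_zero.mp (hsplit.symm.trans hzero)).resolve_right hne
  · refine Finset.sum_eq_zero fun i hi => ?_
    by_contra hci
    exact hx (Finset.mem_image.mpr ⟨i, by simpa using hci, (Finset.mem_filter.mp hi).2⟩)

/-- A word of weight at most `2 * t + 3` whose sums over all blocks and over all points vanish is
zero, if points of a block are far apart with respect to the earlier blocks. -/
lemma eq_zero_of_block_sums_of_point_sums {F V ι : Type*} [Field F] [DecidableEq F]
    [DecidableEq V] [Fintype ι] {A : ℕ → Finset V} {t : ℕ} {blk : ι → ℕ} {pos : ι → V}
    (hmem : ∀ i, pos i ∈ A (blk i))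
    (hinj : ∀ i j, blk i = blk j → pos i = pos j → i = j)
    (hfar : ∀ i, ∀ y ∈ A (blk i), pos i ≠ y →
      y ∉ (expand A (Finset.range (blk i)))^[t] {pos i})
    {c : ι → F} (hc : hammingNorm c ≤ 2 * t + 3)
    (hblk : ∀ b, ∑ i with blk i = b, c i = 0) (hpos : ∀ x, ∑ i with pos i = x, c i = 0) :
    c = 0 := by
  classical
  by_contra hne
  set S := Finset.univ.filter fun i => c i ≠ 0 with hS
  set T := S.image blk
  have hSne : S.Nonempty := by
    obtain ⟨i, hi⟩ := Function.ne_iff.mp hne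
    exact ⟨i, by simpa [hS] using hi⟩
  have htwo : ∀ b ∈ T, 2 ≤ (S.filter fun i => blk i = b).card := by
    intro b hb
    obtain ⟨i, hi, rfl⟩ := Finset.mem_image.mp hb
    by_contra! hlt
    have hmem' : i ∈ S.filter fun j => blk j = blk i := Finset.mem_filter.mpr ⟨hi, rfl⟩
    have huniq : ∀ j, blk j = blk i → j ≠ i → c j = 0 := by
      intro j hj hji
      by_contra hcj
      exact hji (Finset.card_le_one.mp (by omega) j
        (Finset.mem_filter.mpr ⟨by simpa [hS] using hcj, hj⟩) i hmem')
    have hsum := hblk (blk i)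
    rw [Finset.sum_eq_single_of_mem i (by simp)
      (fun j hj hji => huniq j (Finset.mem_filter.mp hj).2 hji)] at hsum
    exact (Finset.mem_filter.mp hi).2 hsum
  have hTcard : T.card ≤ t + 1 := by
    have h1 : S.card = ∑ b ∈ T, (S.filter fun i => blk i = b).card :=
      Finset.card_eq_sum_card_image blk S
    have h2 := Finset.card_nsmul_le_sum T _ 2 htwo
    rw [← h1, smul_eq_mul] at h2
    have h3 : S.card ≤ 2 * t + 3 := hc
    omega
  have hTne : T.Nonempty := hSne.image blk
  obtain ⟨i₀, hi₀, hmax⟩ := Finset.mem_image.mp (T.max'_mem hTne)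
  have hle : ∀ b ∈ T, b ≤ blk i₀ := fun b hb => hmax ▸ T.le_max' b hb
  have hci₀ : c i₀ ≠ 0 := (Finset.mem_filter.mp hi₀).2
  have hTJ : T.erase (blk i₀) ⊆ Finset.range (blk i₀) := fun b hb =>
    Finset.mem_range.mpr (lt_of_le_of_ne (hle b (Finset.mem_of_mem_erase hb))
      (Finset.ne_of_mem_erase hb))
  obtain ⟨K, hiK, hK, hcl⟩ := exists_closed_subset_iterate_expand (A := A) hTJ {pos i₀}
  have hKt : K ⊆ (expand A (Finset.range (blk i₀)))^[t] {pos i₀} := by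
    refine hK.trans (iterate_expand_subset_of_le ?_ _)
    rw [Finset.card_erase_of_mem (show blk i₀ ∈ T from Finset.mem_image_of_mem blk hi₀)]
    omega
  have hsumK : ∑ i with pos i ∈ K, c i = 0 := by
    rw [← Finset.sum_fiberwise_of_maps_to (g := pos) (t := K) (by simp)]
    refine Finset.sum_eq_zero fun x hx => ?_
    rw [Finset.filter_filter, ← hpos x]
    congr 1
    ext i
    simp only [Finset.mem_filter, Finset.mem_univ, true_and]
    grind
  have hsum₀ : ∑ i with pos i ∈ K, c i = c i₀ := by
    rw [← Finset.sum_fiberwise_of_maps_to (g := blk) (t := Finset.univ.image blk) (by simp),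
      Finset.sum_eq_single_of_mem (blk i₀) (by simp)]
    · refine Finset.sum_eq_single_of_mem i₀ ?_ ?_
      · simpa using hiK
      · intro i hi hii₀
        simp only [Finset.mem_filter, Finset.mem_univ, true_and] at hi
        have hp : pos i₀ ≠ pos i := fun h => hii₀ (hinj i i₀ hi.2 h.symm)
        exact absurd (hKt hi.1) (hfar i₀ (pos i) (hi.2 ▸ hmem i) hp)
    · intro b _ hb
      rw [Finset.filter_filter]
      by_cases hbT : b ∈ T
      · rcases hcl b (Finset.mem_erase.mpr ⟨hb, hbT⟩) with h | h
        · refine Finset.sum_eq_zero fun i hi => ?_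
          simp only [Finset.mem_filter, Finset.mem_univ, true_and] at hi
          exact absurd hi.1 (Finset.disjoint_left.mp h (hi.2 ▸ hmem i))
        · rw [← hblk b]
          congr 1
          ext i
          simp only [Finset.mem_filter, Finset.mem_univ, true_and, and_iff_right_iff_imp]
          rintro rfl
          exact h (hmem i)
      · refine Finset.sum_eq_zero fun i hi => ?_
        by_contra hci
        exact hbT (Finset.mem_image.mpr ⟨i, by simpa [hS] using hci, by simp_all⟩)
  exact hci₀ (hsum₀ ▸ hsumK)

/-- The code whose checks are the block sums and the global power moments of orders `1, …, d - 2`. -/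
lemma exists_code_of_blocks_far_apart {F : Type*} [Field F] [DecidableEq F] {m r d t : ℕ}
    {A : ℕ → Finset F} (hA : ∀ i < m, (A i).card = r + 1)
    (hfar : ∀ i < m, ∀ x ∈ A i, ∀ y ∈ A i, x ≠ y → y ∉ (expand A (Finset.range i))^[t] {x})
    (hd : 2 ≤ d) (hdt : d ≤ 2 * t + 4) :
    ∃ C : Submodule F (Fin (m * (r + 1)) → F), HasLocality C r ∧
      m * r ≤ Module.finrank F C + (d - 2) ∧ ∀ c ∈ C, c ≠ 0 → d ≤ hammingNorm c := by
  have henum : ∀ b : Fin m, ∃ e : Fin (r + 1) → F, Function.Injective e ∧ ∀ x, e x ∈ A b :=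
    fun b => ⟨fun x => ((A b).equivFinOfCardEq (hA b b.2)).symm x,
      Subtype.val_injective.comp (Equiv.injective _), fun x => Subtype.coe_prop _⟩
  choose e he heA using henum
  set blk : Fin (m * (r + 1)) → Fin m := fun i => (finProdFinEquiv.symm i).1
  set pos : Fin (m * (r + 1)) → F :=
    fun i => e (blk i) (finProdFinEquiv.symm i).2
  have hmem : ∀ i, pos i ∈ A (blk i) := fun i => heA _ _
  have hinj : ∀ i j, blk i = blk j → pos i = pos j → i = j := by
    intro i j hb hp
    refine finProdFinEquiv.symm.injective (Prod.ext hb (he (blk i) ?_))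
    exact hp.trans (congrArg (fun b => e b (finProdFinEquiv.symm j).2) hb.symm)
  have hcard : ∀ b, (Finset.univ.filter fun i => blk i = b).card ≤ r + 1 := by
    intro b
    refine le_of_le_of_eq ?_ (hA b b.2)
    refine Finset.card_le_card_of_injOn pos (fun i hi => ?_) fun i hi j hj hij => ?_
    · have hi' : blk i = b := by simpa using hi
      exact hi' ▸ hmem i
    · have hi' : blk i = b := by simpa using hi
      have hj' : blk j = b := by simpa using hj
      exact hinj i j (hi'.trans hj'.symm) hij
  let φ : (Fin (m * (r + 1)) → F) →ₗ[F] (Fin m → F) × (Fin (d - 2) → F) :=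
    (LinearMap.pi fun b => ∑ i with blk i = b, LinearMap.proj i).prod
      (LinearMap.pi fun j => ∑ i, pos i ^ (j.1 + 1) • LinearMap.proj i)
  have hφ : ∀ c ∈ LinearMap.ker φ, (∀ b, ∑ i with blk i = b, c i = 0) ∧
      ∀ j < d - 1, ∑ i, c i * pos i ^ j = 0 := by
    intro c hc
    have hc' : φ c = 0 := hc
    have hsum : ∀ b, ∑ i with blk i = b, c i = 0 := fun b => by
      simpa [φ] using congrFun (congrArg Prod.fst hc') b
    refine ⟨hsum, fun j hj => ?_⟩
    rcases j with _ | j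
    · simp only [pow_zero, mul_one]
      rw [← Finset.sum_fiberwise Finset.univ blk]
      exact Finset.sum_eq_zero fun b _ => hsum b
    · have h := congrFun (congrArg Prod.snd hc') ⟨j, by omega⟩
      simpa [φ, mul_comm] using h
  refine ⟨LinearMap.ker φ, fun i => ?_, ?_, fun c hc hne => ?_⟩
  · refine ⟨fun j => if blk j = blk i then 1 else 0, fun c hc => ?_, by simp, ?_⟩
    · simpa [Finset.sum_filter] using (hφ c hc).1 (blk i)
    · refine le_trans (Finset.card_le_card fun j => ?_) (hcard (blk i))
      simp
  · have h1 := φ.finrank_range_add_finrank_ker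
    have h2 := Submodule.finrank_le (LinearMap.range φ)
    simp only [Module.finrank_prod, Module.finrank_fin_fun] at h1 h2
    have h3 : m * (r + 1) = m * r + m := by ring
    omega
  · by_contra! hlt
    obtain ⟨hsum, hmom⟩ := hφ c hc
    refine hne (eq_zero_of_block_sums_of_point_sums (A := A) (t := t) (blk := fun i => (blk i).1)
      hmem (fun i j h => hinj i j (Fin.ext h))
      (fun i y hy h => hfar _ (blk i).2 _ (hmem i) y hy h) (by omega) (fun b => ?_)
      (sum_fiber_eq_zero_of_moments (e := d - 1) (by omega) hmom))
    by_cases hb : b < m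
    · simpa [Fin.ext_iff] using hsum ⟨b, hb⟩
    · refine Finset.sum_eq_zero fun i hi => ?_
      exact absurd ((Finset.mem_filter.mp hi).2 ▸ (blk i).2) hb

/-- The degree bound used in the greedy construction. -/
lemma exists_degree_bound {q n r t : ℕ} (ht : 0 < t) (hq : 0 < q) (hqn : q < n)
    (hn : (n : ℝ) ≤ 1 / (6 * (r + 2) ^ 2) * (q : ℝ) ^ ((1 : ℝ) + 1 / (t : ℝ))) :
    ∃ D : ℕ, 2 * n ≤ D * q ∧ 2 * (r * (D * (r + 1) + 1) ^ t) < q := by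
  have hq' : (0 : ℝ) < q := by exact_mod_cast hq
  set y : ℝ := (q : ℝ) ^ (1 / (t : ℝ)) with hy
  have hyt : y ^ t = q := by
    rw [hy, one_div, Real.rpow_inv_natCast_pow hq'.le ht.ne']
  have hy0 : 0 < y := Real.rpow_pos_of_pos hq' _
  rw [Real.rpow_add hq', Real.rpow_one, ← hy] at hn
  have hqn' : (q : ℝ) < n := by exact_mod_cast hqn
  set D := ⌈2 * (n : ℝ) / q⌉₊ with hD
  have hDlow : 2 * (n : ℝ) / q ≤ D := Nat.le_ceil _
  have hDup : (D : ℝ) < 2 * n / q + 1 := Nat.ceil_lt_add_one (by positivity)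
  have h1 : (1 : ℝ) ≤ n / q := (one_le_div hq').mpr hqn'.le
  have h2 : (n : ℝ) / q ≤ 1 / (6 * (r + 2) ^ 2) * y := by
    rw [div_le_iff₀ hq']
    linarith
  have hD1 : (1 : ℝ) ≤ D := by
    rw [mul_div_assoc] at hDlow
    linarith
  have hbase : (D : ℝ) * (r + 1) + 1 ≤ 1 / (2 * (r + 2)) * y := by
    have h3 : (D : ℝ) ≤ 3 * (1 / (6 * (r + 2) ^ 2) * y) := by
      rw [mul_div_assoc] at hDup
      linarith
    calc (D : ℝ) * (r + 1) + 1 ≤ D * (r + 2) := by linarith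
      _ ≤ 3 * (1 / (6 * (r + 2) ^ 2) * y) * (r + 2) := by gcongr
      _ = 1 / (2 * (r + 2)) * y := by field_simp; norm_num
  have hpow : ((D : ℝ) * (r + 1) + 1) ^ t ≤ 1 / (2 * (r + 2)) * q := by
    calc ((D : ℝ) * (r + 1) + 1) ^ t ≤ (1 / (2 * (r + 2)) * y) ^ t := by gcongr
      _ = (1 / (2 * (r + 2))) ^ t * q := by rw [mul_pow, hyt]
      _ ≤ 1 / (2 * (r + 2)) * q := by
        gcongr
        refine pow_le_of_le_one (by positivity) ?_ ht.ne'
        rw [div_le_one (by positivity)]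
        have : (0 : ℝ) ≤ r := r.cast_nonneg
        linarith
  refine ⟨D, ?_, ?_⟩
  · rw [div_le_iff₀ hq'] at hDlow
    exact_mod_cast hDlow
  · have : 2 * ((r : ℝ) * (D * (r + 1) + 1) ^ t) < q :=
      calc 2 * ((r : ℝ) * (D * (r + 1) + 1) ^ t) ≤ 2 * (r * (1 / (2 * (r + 2)) * q)) := by gcongr
        _ = r / (r + 2) * q := by field_simp
        _ < 1 * q := by
          gcongr
          rw [div_lt_one (by positivity)]
          linarith
        _ = q := one_mul _
    exact_mod_cast this

/-- For `5 ≤ d ≤ r+2` there is a constant `η = η(d,r) > 0` such that over any finite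
field of size `q`, for any `n` with `(r+1) ∣ n`, `q(r+1) < n ≤ η·q^{1+1/⌊(d-3)/2⌋}`,
there exists an optimal LRC of length `n`, locality `r` and minimum distance `≥ d`. -/
theorem stmt_11 {d r : ℕ} (hd5 : 5 ≤ d) (hdr : d ≤ r + 2) :
    ∃ η : ℝ, 0 < η ∧
      ∀ (F : Type) [Field F] [Fintype F] [DecidableEq F] (n : ℕ), 0 < n →
        (r + 1) ∣ n → Fintype.card F * (r + 1) < n →
        (n : ℝ) ≤ η * (Fintype.card F : ℝ) ^
          ((1 : ℝ) + 1 / ((((d - 3) / 2 : ℕ) : ℝ))) →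
        ∃ C : Submodule F (Fin n → F),
          HasLocality C r ∧
          ((n : ℤ) - ((n / (r + 1) : ℕ) : ℤ) - ((d : ℤ) - 2) ≤
            (Module.finrank F ↥C : ℤ)) ∧
          (∀ c ∈ C, c ≠ 0 → d ≤ hammingNorm c) ∧
          (d - 2 < r →
            ∀ c ∈ C, c ≠ 0 →
              (n : ℤ) - (Module.finrank F ↥C : ℤ) -
                  ⌈(Module.finrank F ↥C : ℚ) / (r : ℚ)⌉ + 2 ≤ (hammingNorm c : ℤ)) ∧
          (d - 2 = r →
            ∀ c ∈ C, c ≠ 0 →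
              (n : ℤ) - (Module.finrank F ↥C : ℤ) -
                  ⌈(Module.finrank F ↥C : ℚ) / (r : ℚ)⌉ + 1 ≤ (hammingNorm c : ℤ)) := by
  refine ⟨1 / (6 * (r + 2) ^ 2), by positivity, ?_⟩
  intro F _ _ _ n _ hdvd hqn hn
  obtain ⟨m, rfl⟩ : ∃ m, n = m * (r + 1) := by
    obtain ⟨m, rfl⟩ := hdvd
    exact ⟨m, mul_comm _ _⟩
  obtain ⟨D, hD, hDq⟩ := exists_degree_bound (t := (d - 3) / 2) (by omega) Fintype.card_pos
    ((Nat.le_mul_of_pos_right _ r.succ_pos).trans_lt hqn) hn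
  obtain ⟨A, hA, hfar⟩ := exists_blocks_far_apart F hD hDq
  obtain ⟨C, hloc, hdim, hdist⟩ := exists_code_of_blocks_far_apart (d := d) hA hfar
    (by omega) (by omega)
  have hr : (0 : ℚ) < r := by
    have : 0 < r := by omega
    exact_mod_cast this
  have hceil : ∀ a : ℤ, (a - 1) * r < Module.finrank F C →
      a ≤ ⌈(Module.finrank F C : ℚ) / (r : ℚ)⌉ := by
    intro a ha
    rw [Int.le_ceil_iff, lt_div_iff₀ hr]
    exact_mod_cast ha
  have hdim' : (m : ℤ) * r ≤ Module.finrank F C + (d - 2) := by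
    have : ((d - 2 : ℕ) : ℤ) = d - 2 := by omega
    rw [← this]
    exact_mod_cast hdim
  have hlen : ((m * (r + 1) : ℕ) : ℤ) = m * r + m := by
    push_cast
    ring
  refine ⟨C, hloc, ?_, hdist, fun h c hc hne => ?_, fun h c hc hne => ?_⟩
  · rw [Nat.mul_div_cancel _ r.succ_pos, hlen]
    linarith
  · have h1 := hceil m (by rw [sub_mul, one_mul]; omega)
    have h2 := hdist c hc hne
    omega
  · have h1 := hceil (m - 1) (by rw [sub_mul, sub_mul, one_mul]; omega)
    have h2 := hdist c hc hne
    omega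
end

section
/- Let d and r be integers with d ≥ 5 and r ≥ 1. Then there exists a real constant η > 0, depending only on d and r, such that for every finite field F with q = |F| and every positive integer ℓ with n := ℓ(r+1) satisfying q(r+1) < n and (as real numbers) n ≤ η · q^(1 + 1/⌊(d-3)/2⌋), there exists a family of vectors v : Fin ℓ × Fin (r+1) → (Fin (d-2) → F) such that, defining H(i,j) ∈ (Fin ℓ → F) × (Fin (d-2) → F) by H(i,j) = (Pi.single i 1, v(i,j)), every subfamily of at most d-1 distinct vectors H(i,j) is linearly independent over F. -/
open Finset in
/-- Vectors supported on `s` with prescribed row sums are determined by their values off a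
transversal of the rows meeting `s`. -/
theorem card_filter_support_subset_rowSum_le {α κ F : Type*} [Fintype α] [Fintype κ]
    [DecidableEq α] [DecidableEq κ] [Field F] [Fintype F] [DecidableEq F]
    (s : Finset (α × κ)) (b : α → F) :
    #{c : α × κ → F | (∀ u ∉ s, c u = 0) ∧ ∀ a, ∑ j, c (a, j) = b a} ≤
      Fintype.card F ^ (#s - #(s.image Prod.fst)) := by
  obtain ⟨R, hRs, hinj, himg⟩ := exists_subset_injOn_image_eq_of_surjOn (f := Prod.fst)
    (s : Set (α × κ)) (s.image Prod.fst) (by rw [coe_image]; exact Set.surjOn_image _ _)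
  have hRs' : R ⊆ s := by exact_mod_cast hRs
  have hcard : #(s \ R) = #s - #(s.image Prod.fst) := by
    rw [card_sdiff_of_subset hRs', ← himg, card_image_of_injOn hinj]
  have huniv : #(univ : Finset ({u // u ∈ s \ R} → F)) =
      Fintype.card F ^ (#s - #(s.image Prod.fst)) := by
    rw [card_univ, Fintype.card_fun, Fintype.card_coe, hcard]
  rw [← huniv]
  refine card_le_card_of_injOn (fun c u => c u.1) (fun _ _ => mem_coe.2 (mem_univ _)) ?_
  intro c hc c' hc' h
  simp only [coe_filter, mem_univ, true_and, Set.mem_ofPred_eq] at hc hc'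
  have hoff : ∀ u ∉ R, c u = c' u := by
    intro u hu
    by_cases hus : u ∈ s
    · exact congrFun h ⟨u, mem_sdiff.2 ⟨hus, hu⟩⟩
    · rw [hc.1 u hus, hc'.1 u hus]
  funext u
  by_cases hu : u ∈ R
  · obtain ⟨a, j⟩ := u
    have hsum : ∑ k, (c (a, k) - c' (a, k)) = 0 := by
      rw [sum_sub_distrib, hc.2, hc'.2, sub_self]
    rw [sum_eq_single j] at hsum
    · exact sub_eq_zero.1 hsum
    · intro k _ hk
      refine sub_eq_zero.2 (hoff _ fun hkR => hk ?_)
      exact congrArg Prod.snd (hinj (mem_coe.2 hkR) (mem_coe.2 hu) rfl)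
    · simp
  · exact hoff u hu

open Finset in
/-- If the row sums of `c` are those of a unit vector, then the row of the unit meets the support
of `c`, and every other row meeting the support does so at least twice. -/
theorem two_mul_card_image_support_le_of_rowSum {α κ F : Type*} [Fintype α] [Fintype κ]
    [DecidableEq α] [DecidableEq κ] [Field F] [DecidableEq F]
    (a₀ : α) (c : α × κ → F) (hc : ∀ a, ∑ j, c (a, j) = (Pi.single a₀ 1 : α → F) a) :
    a₀ ∈ (univ.filter fun u => c u ≠ 0).image Prod.fst ∧
      2 * #((univ.filter fun u => c u ≠ 0).image Prod.fst) ≤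
        #(univ.filter fun u => c u ≠ 0) + 1 := by
  set s := univ.filter fun u => c u ≠ 0 with hs
  have h₀ : a₀ ∈ s.image Prod.fst := by
    by_contra hcon
    have hz : ∀ j, c (a₀, j) = 0 := by
      intro j
      by_contra hj
      exact hcon (mem_image.2 ⟨(a₀, j), by simp [hs, hj], rfl⟩)
    simpa [hz] using hc a₀
  refine ⟨h₀, ?_⟩
  have hfib : ∀ a ∈ (s.image Prod.fst).erase a₀, 2 ≤ #{u ∈ s | u.1 = a} := by
    intro a ha
    obtain ⟨hne, ha⟩ := mem_erase.1 ha
    obtain ⟨⟨a', j⟩, hu, rfl⟩ := mem_image.1 ha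
    by_contra hlt
    have hone : #{u ∈ s | u.1 = a'} ≤ 1 := Nat.lt_succ_iff.1 (not_le.1 hlt)
    have hsum := hc a'
    rw [Pi.single_eq_of_ne hne, sum_eq_single j] at hsum
    · exact (mem_filter.1 hu).2 hsum
    · intro k _ hk
      by_contra hck
      exact hk (congrArg Prod.snd (card_le_one.1 hone (a', k) (by simp [hs, hck]) (a', j)
        (mem_filter.2 ⟨hu, rfl⟩)))
    · simp
  have h₁ : 1 ≤ #{u ∈ s | u.1 = a₀} := by
    obtain ⟨u, hu, hua⟩ := mem_image.1 h₀
    exact card_pos.2 ⟨u, mem_filter.2 ⟨hu, hua⟩⟩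
  have htot : #s = ∑ a ∈ s.image Prod.fst, #{u ∈ s | u.1 = a} :=
    card_eq_sum_card_image _ _
  have hge := card_nsmul_le_sum _ _ _ hfib
  rw [smul_eq_mul] at hge
  rw [← add_sum_erase _ _ h₀] at htot
  have := card_erase_add_one h₀
  omega

open Finset in
/-- There are at most `K * |α| ^ T * q ^ (m - (T + 1))` vectors of weight at most `m` whose row
sums form a unit vector, where `T = (m - 1) / 2` and `K` depends only on `m` and `|κ|`. -/
theorem card_filter_rowSum_eq_single_le {α κ F : Type*} [Fintype α] [Fintype κ]
    [DecidableEq α] [DecidableEq κ] [Field F] [Fintype F] [DecidableEq F]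
    (a₀ : α) {m : ℕ} (hm : 1 ≤ m) (hq : Fintype.card F ≤ Fintype.card α) :
    #{c : α × κ → F | #{u | c u ≠ 0} ≤ m ∧
        ∀ a, ∑ j, c (a, j) = (Pi.single a₀ 1 : α → F) a} ≤
      ((m - 1) / 2 + 1) * 2 ^ (((m - 1) / 2 + 1) * Fintype.card κ) *
        (Fintype.card α ^ ((m - 1) / 2) * Fintype.card F ^ (m - ((m - 1) / 2 + 1))) := by
  set T := (m - 1) / 2 with hT
  set q := Fintype.card F with hqdef
  set L := Fintype.card α with hL
  have hq0 : 0 < q := Fintype.card_pos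
  let C (s : Finset (α × κ)) : Finset (α × κ → F) :=
    {c | (∀ u ∉ s, c u = 0) ∧ ∀ a, ∑ j, c (a, j) = (Pi.single a₀ 1 : α → F) a}
  let S (t : ℕ) (G : Finset α) : Finset (Finset (α × κ)) :=
    {s ∈ (insert a₀ G ×ˢ (univ : Finset κ)).powerset | #s ≤ m ∧ #(s.image Prod.fst) = t + 1}
  have hcover : ({c : α × κ → F | #{u | c u ≠ 0} ≤ m ∧
        ∀ a, ∑ j, c (a, j) = (Pi.single a₀ 1 : α → F) a} : Finset (α × κ → F)) ⊆
      (range (T + 1)).biUnion fun t => (powersetCard t univ).biUnion fun G =>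
        (S t G).biUnion C := by
    intro c hc
    obtain ⟨hcm, hc⟩ := (mem_filter.1 hc).2
    obtain ⟨h₀, h2⟩ := two_mul_card_image_support_le_of_rowSum a₀ c hc
    set s := univ.filter fun u => c u ≠ 0 with hs
    have hcard := card_erase_add_one h₀
    refine mem_biUnion.2 ⟨#((s.image Prod.fst).erase a₀), mem_range.2 (by omega), ?_⟩
    refine mem_biUnion.2 ⟨(s.image Prod.fst).erase a₀,
      mem_powersetCard.2 ⟨subset_univ _, rfl⟩, ?_⟩
    refine mem_biUnion.2 ⟨s, mem_filter.2 ⟨mem_powerset.2 ?_, hcm, hcard.symm⟩, ?_⟩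
    · intro u hu
      rw [insert_erase h₀]
      exact mem_product.2 ⟨mem_image_of_mem _ hu, mem_univ _⟩
    · refine mem_filter.2 ⟨mem_univ _, fun u hu => ?_, hc⟩
      by_contra hcu
      exact hu (by simp [hs, hcu])
  have hT_le : ∀ t ≤ T, ∀ G ∈ powersetCard t (univ : Finset α),
      #((S t G).biUnion C) ≤ 2 ^ ((T + 1) * Fintype.card κ) * q ^ (m - (t + 1)) := by
    intro t ht G hG
    refine (card_biUnion_le_card_mul _ _ (q ^ (m - (t + 1))) fun s hs => ?_).trans
      (Nat.mul_le_mul_right _ ?_)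
    · obtain ⟨hsm, hst⟩ := (mem_filter.1 hs).2
      refine (card_filter_support_subset_rowSum_le s _).trans (Nat.pow_le_pow_right hq0 ?_)
      omega
    · refine (card_filter_le _ _).trans ?_
      rw [card_powerset, card_product, card_univ]
      refine Nat.pow_le_pow_right two_pos (Nat.mul_le_mul_right _ ?_)
      have h1 := card_insert_le a₀ G
      have h2 := (mem_powersetCard.1 hG).2
      omega
  have ht : ∀ t ∈ range (T + 1),
      #((powersetCard t univ).biUnion fun G => (S t G).biUnion C) ≤
        2 ^ ((T + 1) * Fintype.card κ) * (L ^ T * q ^ (m - (T + 1))) := by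
    intro t ht
    have htT : t ≤ T := Nat.lt_succ_iff.1 (mem_range.1 ht)
    refine (card_biUnion_le_card_mul _ _ _ (hT_le t htT)).trans ?_
    rw [card_powersetCard, card_univ, ← hL, mul_left_comm]
    refine Nat.mul_le_mul_left _ ?_
    have hexp : m - (t + 1) = (T - t) + (m - (T + 1)) := by omega
    calc L.choose t * q ^ (m - (t + 1))
        ≤ L ^ t * (L ^ (T - t) * q ^ (m - (T + 1))) := by
          rw [hexp, pow_add]
          gcongr
          exact Nat.choose_le_pow _ _
      _ = L ^ T * q ^ (m - (T + 1)) := by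
          rw [← mul_assoc, ← pow_add, Nat.add_sub_cancel' htT]
  refine (card_le_card hcover).trans ((card_biUnion_le_card_mul _ _ _ ht).trans ?_)
  rw [card_range, mul_assoc]

open Finset in
/-- Greedy construction: if the coefficient vectors that could produce a dependence with a new
column are fewer than the possible columns, all columns can be chosen one after another. -/
theorem exists_columns_linearIndepOn {α κ F W : Type*} [Fintype α] [Fintype κ]
    [DecidableEq α] [DecidableEq κ] [Field F] [Fintype F] [DecidableEq F]
    [AddCommGroup W] [Module F W] [Fintype W] [DecidableEq W] {m : ℕ}
    (hbad : ∀ a₀ : α, #{c : α × κ → F | #{u | c u ≠ 0} ≤ m ∧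
        ∀ a, ∑ j, c (a, j) = (Pi.single a₀ 1 : α → F) a} < Fintype.card W)
    (S : Finset (α × κ)) :
    ∃ v : α × κ → W, ∀ s ⊆ S, #s ≤ m + 1 →
      LinearIndepOn F (fun p => ((Pi.single p.1 1 : α → F), v p)) (s : Set (α × κ)) := by
  induction S using Finset.induction_on with
  | empty =>
    refine ⟨0, fun s hs _ => ?_⟩
    rw [subset_empty.1 hs, coe_empty]
    exact linearIndepOn_empty _ _
  | insert p S hp ih =>
    obtain ⟨v, hv⟩ := ih
    obtain ⟨x, hx⟩ : ∃ x : W, x ∉ ({c : α × κ → F | #{u | c u ≠ 0} ≤ m ∧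
        ∀ a, ∑ j, c (a, j) = (Pi.single p.1 1 : α → F) a} : Finset _).image
          fun c => ∑ u, c u • v u := by
      by_contra! hall
      have := card_le_card (fun x _ => hall x : (univ : Finset W) ⊆ _)
      exact absurd (this.trans card_image_le) (not_le.2 (by simpa using hbad p.1))
    refine ⟨Function.update v p x, fun s hs hsm => ?_⟩
    have hcongr : ∀ t : Finset (α × κ), p ∉ t →
        Set.EqOn (fun u => ((Pi.single u.1 1 : α → F), v u))
          (fun u => ((Pi.single u.1 1 : α → F), Function.update v p x u))
            (t : Set (α × κ)) := by
      intro t ht u hu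
      have : u ≠ p := fun h => ht (h ▸ mem_coe.1 hu)
      simp [Function.update_of_ne this]
    by_cases hps : p ∈ s
    · have hsS : s.erase p ⊆ S := fun u hu =>
        (mem_insert.1 (hs (mem_of_mem_erase hu))).resolve_left (ne_of_mem_erase hu)
      have hnot := notMem_erase p s
      have hcard := card_erase_add_one hps
      have hEq := hcongr _ hnot
      rw [← insert_erase hps, coe_insert, linearIndepOn_insert (by simp)]
      refine ⟨(hv _ hsS (by omega)).congr hEq, fun hmem => hx ?_⟩
      rw [← hEq.image_eq, Submodule.mem_span_image_finset_iff_exists_fun'] at hmem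
      obtain ⟨c, hc⟩ := hmem
      set c' : α × κ → F := fun u => if u ∈ s.erase p then c u else 0 with hc'
      have hfull : ∑ u, c' u • ((Pi.single u.1 1 : α → F), v u) =
          ((Pi.single p.1 1 : α → F), x) := by
        simpa [hc', ite_smul, sum_ite_mem, -mem_erase] using hc
      refine mem_image.2 ⟨c', mem_filter.2 ⟨mem_univ _, ?_, fun a => ?_⟩, ?_⟩
      · refine (card_le_card (t := s.erase p) fun u hu => ?_).trans (by omega)
        by_contra hcon
        exact (mem_filter.1 hu).2 (if_neg hcon)
      · have := congrFun (congrArg Prod.fst hfull) a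
        rw [Prod.fst_sum, Finset.sum_apply, Fintype.sum_prod_type] at this
        refine Eq.trans ?_ this
        rw [sum_eq_single a]
        · simp
        · intro b _ hb
          simp [Pi.single_eq_of_ne hb.symm]
        · simp
      · simpa [Prod.snd_sum] using congrArg Prod.snd hfull
    · refine (hv s (fun u hu => ?_) hsm).congr (hcongr s hps)
      exact (mem_insert.1 (hs hu)).resolve_left fun h => hps (h ▸ hu)

/-- For `d ≥ 5`, `r ≥ 1` there is a constant `η = η(d,r) > 0` such that over any finite
field of size `q`, whenever `n = ℓ(r+1)` satisfies `q(r+1) < n ≤ η·q^{1+1/⌊(d-3)/2⌋}`,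
there exists a family `v(i,j) ∈ F^{d-2}` such that, with `H(i,j) = (e_i, v(i,j))`, any
`d-1` distinct columns `H(i,j)` are linearly independent. -/
theorem stmt_12 {d r : ℕ} (hd5 : 5 ≤ d) (hr : 1 ≤ r) :
    ∃ η : ℝ, 0 < η ∧
      ∀ (F : Type) [Field F] [Fintype F] [DecidableEq F] (ℓ : ℕ), 0 < ℓ →
        Fintype.card F * (r + 1) < ℓ * (r + 1) →
        ((ℓ * (r + 1) : ℕ) : ℝ) ≤ η * (Fintype.card F : ℝ) ^
          ((1 : ℝ) + 1 / ((((d - 3) / 2 : ℕ) : ℝ))) →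
        ∃ v : Fin ℓ × Fin (r + 1) → (Fin (d - 2) → F),
          ∀ s : Finset (Fin ℓ × Fin (r + 1)), s.card ≤ d - 1 →
            LinearIndependent F
              (fun p : {x // x ∈ s} =>
                ((Pi.single p.1.1 (1 : F) : Fin ℓ → F), v p.1)) := by
  set T := (d - 3) / 2 with hT
  have hT1 : 1 ≤ T := by omega
  set K : ℕ := (T + 1) * 2 ^ ((T + 1) * (r + 1)) with hK
  refine ⟨1 / (K + 1), by positivity, ?_⟩
  intro F _ _ _ ℓ hℓ hlow hup
  set q := Fintype.card F with hq
  have hq0 : 0 < q := Fintype.card_pos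
  have hqℓ : q < ℓ := lt_of_mul_lt_mul_right hlow (Nat.zero_le _)
  have hK0 : (0 : ℝ) ≤ K := Nat.cast_nonneg _
  have hmain : K * ℓ ^ T < q ^ (T + 1) := by
    have hη1 : (1 : ℝ) / (K + 1) ≤ 1 := by
      rw [div_le_one (by positivity)]
      linarith
    have hℓle : (ℓ : ℝ) ≤ 1 / (K + 1) * (q : ℝ) ^ ((1 : ℝ) + 1 / (T : ℝ)) := by
      refine le_trans ?_ hup
      exact_mod_cast Nat.le_mul_of_pos_right ℓ (Nat.succ_pos r)
    have hrpow : ((q : ℝ) ^ ((1 : ℝ) + 1 / (T : ℝ))) ^ T = (q : ℝ) ^ (T + 1) := by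
      have hT0 : (T : ℝ) ≠ 0 := by positivity
      rw [← Real.rpow_natCast, ← Real.rpow_mul (Nat.cast_nonneg _), ← Real.rpow_natCast]
      congr 1
      push_cast
      field_simp
    have hpow : (ℓ : ℝ) ^ T ≤ 1 / (K + 1) * (q : ℝ) ^ (T + 1) := by
      calc (ℓ : ℝ) ^ T ≤ (1 / (K + 1) * (q : ℝ) ^ ((1 : ℝ) + 1 / (T : ℝ))) ^ T := by gcongr
        _ = (1 / (K + 1)) ^ T * (q : ℝ) ^ (T + 1) := by rw [mul_pow, hrpow]
        _ ≤ 1 / (K + 1) * (q : ℝ) ^ (T + 1) := by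
          gcongr
          exact pow_le_of_le_one (by positivity) hη1 (by omega)
    have hℓT : (0 : ℝ) < (ℓ : ℝ) ^ T := by positivity
    rw [one_div, inv_mul_eq_div, le_div_iff₀ (by positivity)] at hpow
    have : (K : ℝ) * (ℓ : ℝ) ^ T < (q : ℝ) ^ (T + 1) := by linarith
    exact_mod_cast this
  obtain ⟨v, hv⟩ := exists_columns_linearIndepOn (α := Fin ℓ) (κ := Fin (r + 1)) (F := F)
    (W := Fin (d - 2) → F) (m := d - 2) (fun a₀ => by
      refine (card_filter_rowSum_eq_single_le a₀ (by omega) (by simpa using hqℓ.le)).trans_lt ?_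
      have hT' : (d - 2 - 1) / 2 = T := by omega
      have hexp : d - 2 = (T + 1) + (d - 2 - (T + 1)) := by omega
      rw [hT', Fintype.card_fun, Fintype.card_fin, Fintype.card_fin, Fintype.card_fin, ← hK,
        ← hq, ← mul_assoc]
      calc K * ℓ ^ T * q ^ (d - 2 - (T + 1)) < q ^ (T + 1) * q ^ (d - 2 - (T + 1)) := by gcongr
        _ = q ^ (d - 2) := by rw [← pow_add, ← hexp]) Finset.univ
  exact ⟨v, fun s hs => hv s (Finset.subset_univ s) (by omega)⟩
end

section
/- Let d, r, a be integers with 5 ≤ d ≤ r + 2 and d - 1 < a ≤ r. Then there exists a real constant η > 0, depending only on d and r, such that for every finite field F with q = |F| and every positive integer n with n ≡ a (mod r+1), q(r+1) < n, and (as real numbers) n ≤ η · q^(1 + 1/⌊(d-3)/2⌋), there exists a linear code C of length n over F such that: (i) C has locality r; (ii) the dimension k = Module.finrank F C satisfies k ≥ n - ⌈n/(r+1)⌉ - (d-2); (iii) every nonzero codeword of C has Hamming weight at least d; and (iv) every nonzero codeword of C has Hamming weight at least n - k - ⌈k/r⌉ + 2 (with ⌈·⌉ denoting ceilings of the corresponding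 rationals). -/
open Finset

section Hypergraph

variable {V : Type*}

/-- Two vertices lie on a common edge of the hypergraph `S`. -/
def Linked (S : Finset (Finset V)) (u v : V) : Prop := ∃ e ∈ S, u ∈ e ∧ v ∈ e

/-- Two vertices lie in the same connected component of the hypergraph `S`. -/
def Connects (S : Finset (Finset V)) : V → V → Prop := Relation.ReflTransGen (Linked S)

/-- Every choice of at least two vertices from each of at most `t` edges of `H` covers
two distinct vertices exactly once. -/
def HasLeaves (t : ℕ) (H : Finset (Finset V)) : Prop :=
  ∀ S ⊆ H, S.Nonempty → #S ≤ t → ∀ g : Finset V → Finset V,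
    (∀ e ∈ S, g e ⊆ e ∧ 2 ≤ #(g e)) →
    ∃ x y, x ≠ y ∧ (∃! e, e ∈ S ∧ x ∈ g e) ∧ (∃! e, e ∈ S ∧ y ∈ g e)

theorem Connects.symm {S : Finset (Finset V)} {u v : V} (h : Connects S u v) :
    Connects S v u := by
  have hsymm : Std.Symm (Linked S) := ⟨fun _ _ ⟨e, he, hu, hv⟩ => ⟨e, he, hv, hu⟩⟩
  exact Relation.ReflTransGen.stdSymm.symm _ _ h

theorem hasLeaves_empty (t : ℕ) : HasLeaves t (∅ : Finset (Finset V)) := by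
  intro S hS hne
  exact absurd (subset_empty.1 hS) hne.ne_empty

variable [DecidableEq V]

/-- The vertices at distance at most `k` from a given vertex in the hypergraph `H`. -/
def hyperball (H : Finset (Finset V)) : ℕ → V → Finset V
  | 0, u => {u}
  | k + 1, u => (insert u ((H.filter (u ∈ ·)).biUnion id)).biUnion (hyperball H k)

theorem Connects.erase_or {S : Finset (Finset V)} {u v : V} (h : Connects S u v)
    (e : Finset V) :
    Connects (S.erase e) u v ∨ ∃ w ∈ e, Connects (S.erase e) w v := by
  induction h with
  | refl => exact Or.inl .refl
  | @tail b c _ hbc ih =>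
    obtain ⟨f, hf, hb, hc⟩ := hbc
    by_cases hfe : f = e
    · exact Or.inr ⟨c, hfe ▸ hc, .refl⟩
    · have hstep : Linked (S.erase e) b c := ⟨f, mem_erase.2 ⟨hfe, hf⟩, hb, hc⟩
      exact ih.imp (·.tail hstep) fun ⟨w, hw, h⟩ => ⟨w, hw, h.tail hstep⟩

theorem self_mem_hyperball (H : Finset (Finset V)) (k : ℕ) (u : V) :
    u ∈ hyperball H k u := by
  induction k with
  | zero => simp [hyperball]
  | succ k ih => exact mem_biUnion.2 ⟨u, mem_insert_self _ _, ih⟩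

theorem Connects.mem_hyperball {H S : Finset (Finset V)} (hS : S ⊆ H) {k : ℕ}
    (hk : #S ≤ k) {u v : V} (h : Connects S u v) : v ∈ hyperball H k u := by
  induction k generalizing S u with
  | zero =>
    obtain rfl : S = ∅ := by simpa using hk
    rcases Relation.ReflTransGen.cases_head h with rfl | ⟨_, ⟨_, he, _⟩, _⟩
    · exact self_mem_hyperball _ _ _
    · simp at he
  | succ k ih =>
    rcases Relation.ReflTransGen.cases_head h with rfl | ⟨_, ⟨e, he, hu, _⟩, _⟩
    · exact self_mem_hyperball _ _ _
    have ih' : ∀ w, Connects (S.erase e) w v → v ∈ hyperball H k w := fun w hw =>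
      ih ((erase_subset _ _).trans hS) (by rw [card_erase_of_mem he]; omega) hw
    rcases h.erase_or e with h | ⟨w, hw, h⟩
    · exact mem_biUnion.2 ⟨u, mem_insert_self _ _, ih' u h⟩
    · exact mem_biUnion.2 ⟨w, mem_insert_of_mem <| mem_biUnion.2
        ⟨e, mem_filter.2 ⟨hS he, hu⟩, hw⟩, ih' w h⟩

theorem card_hyperball_le {H : Finset (Finset V)} {b D : ℕ} (hb : ∀ e ∈ H, #e ≤ b)
    (hD : ∀ v, #(H.filter (v ∈ ·)) ≤ D) (k : ℕ) (u : V) :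
    #(hyperball H k u) ≤ (1 + D * b) ^ k := by
  induction k generalizing u with
  | zero => simp [hyperball]
  | succ k ih =>
    refine (card_biUnion_le_card_mul _ _ _ fun w _ => ih w).trans ?_
    rw [pow_succ']
    refine Nat.mul_le_mul_right _ ((card_insert_le _ _).trans ?_)
    have h1 := card_biUnion_le_card_mul (H.filter (u ∈ ·)) id b
      fun e he => hb e (mem_filter.1 he).1
    have h2 := Nat.mul_le_mul_right b (hD u)
    omega

/-- Adding an edge whose vertices are pairwise far apart preserves `HasLeaves`. -/
theorem HasLeaves.insert {t : ℕ} {H : Finset (Finset V)} (hH : HasLeaves (t + 1) H)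
    {e : Finset V}
    (he : ∀ S ⊆ H, #S ≤ t → ∀ u ∈ e, ∀ v ∈ e, Connects S u v → u = v) :
    HasLeaves (t + 1) (insert e H) := by
  intro S hS hne hcard g hg
  by_cases heS : e ∈ S
  swap
  · exact hH S (fun f hf => (mem_insert.1 (hS hf)).resolve_left
      fun h => heS (h ▸ hf)) hne hcard g hg
  have hsub : S.erase e ⊆ H := fun f hf =>
    (mem_insert.1 (hS (mem_erase.1 hf).2)).resolve_left (mem_erase.1 hf).1
  have hfar := he (S.erase e) hsub (by rw [card_erase_of_mem heS]; omega)
  have key : ∀ u ∈ g e, ∃ x, Connects (S.erase e) u x ∧ ∃! f, f ∈ S ∧ x ∈ g f := by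
    classical
    intro u hu
    by_cases hleaf : ∃ f ∈ S.erase e, u ∈ g f
    swap
    · refine ⟨u, .refl, e, ⟨heS, hu⟩, fun f hf => ?_⟩
      by_contra hfe
      exact hleaf ⟨f, mem_erase.2 ⟨hfe, hf.1⟩, hf.2⟩
    obtain ⟨f₀, hf₀, huf₀⟩ := hleaf
    let T := (S.erase e).filter fun f => ∃ w ∈ f, Connects (S.erase e) u w
    have hTS : T ⊆ S.erase e := filter_subset _ _
    have hgS : ∀ f ∈ S.erase e, g f ⊆ f := fun f hf => (hg f (mem_erase.1 hf).2).1
    have hex : ∃ x, x ≠ u ∧ ∃! f, f ∈ T ∧ x ∈ g f := by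
      obtain ⟨x, y, hxy, hx, hy⟩ := hH T (hTS.trans hsub)
        ⟨f₀, mem_filter.2 ⟨hf₀, u, hgS _ hf₀ huf₀, .refl⟩⟩
        ((card_le_card (hTS.trans (erase_subset _ _))).trans hcard) g
        fun f hf => hg f (mem_erase.1 (hTS hf)).2
      by_cases hxu : x = u
      · exact ⟨y, fun h => hxy (hxu.trans h.symm), hy⟩
      · exact ⟨x, hxu, hx⟩
    obtain ⟨x, hxu, f, ⟨hfT, hxf⟩, huniq⟩ := hex
    obtain ⟨hfS, w, hwf, hw⟩ := mem_filter.1 hfT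
    have hux : Connects (S.erase e) u x := hw.tail ⟨f, hfS, hwf, hgS f hfS hxf⟩
    refine ⟨x, hux, f, ⟨(mem_erase.1 hfS).2, hxf⟩, fun f' ⟨hf', hxf'⟩ => ?_⟩
    by_cases hfe : f' = e
    · subst hfe
      exact absurd (hfar u ((hg _ heS).1 hu) x ((hg _ heS).1 hxf') hux) (Ne.symm hxu)
    · have hf'S : f' ∈ S.erase e := mem_erase.2 ⟨hfe, hf'⟩
      exact huniq f' ⟨mem_filter.2 ⟨hf'S, x, hgS _ hf'S hxf', hux⟩, hxf'⟩
  obtain ⟨u, hu, v, hv, huv⟩ := one_lt_card.1 (hg e heS).2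
  obtain ⟨x, hux, hx⟩ := key u hu
  obtain ⟨y, hvy, hy⟩ := key v hv
  refine ⟨x, y, ?_, hx, hy⟩
  rintro rfl
  exact huv (hfar u ((hg e heS).1 hu) v ((hg e heS).1 hv) (hux.trans hvy.symm))

/-- Greedy choice of `b` points outside `X`, no two of which are related by `N`. -/
theorem exists_finset_card_eq_pairwise_notMem [Fintype V] (X : Finset V)
    (N : V → Finset V) {B : ℕ} (hB : ∀ v, #(N v) ≤ B) (hself : ∀ v, v ∈ N v) (b : ℕ)
    (hb : #X + (b - 1) * B < Fintype.card V) :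
    ∃ e : Finset V, #e = b ∧ Disjoint e X ∧
      ∀ u ∈ e, ∀ v ∈ e, u ≠ v → v ∉ N u ∨ u ∉ N v := by
  induction b with
  | zero => exact ⟨∅, by simp⟩
  | succ b ih =>
    have hmono : (b - 1) * B ≤ b * B := Nat.mul_le_mul_right _ (Nat.sub_le _ _)
    simp only [Nat.add_sub_cancel] at hb
    obtain ⟨e, hcard, hdisj, hpair⟩ := ih (by omega)
    have hlt : #(X ∪ e.biUnion N) < #(univ : Finset V) := by
      have h1 := card_union_le X (e.biUnion N)
      have h2 := card_biUnion_le_card_mul e N B fun v _ => hB v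
      rw [hcard] at h2
      rw [card_univ]
      omega
    obtain ⟨w, -, hw⟩ := exists_mem_notMem_of_card_lt_card hlt
    simp only [mem_union, mem_biUnion, not_or, not_exists, not_and] at hw
    have hwe : w ∉ e := fun h => hw.2 w h (hself w)
    refine ⟨insert w e, by rw [card_insert_of_notMem hwe, hcard],
      disjoint_insert_left.2 ⟨hw.1, hdisj⟩, ?_⟩
    intro u hu v hv huv
    rcases mem_insert.1 hu with rfl | hue <;> rcases mem_insert.1 hv with rfl | hve
    · exact absurd rfl huv
    · exact Or.inr (hw.2 v hve)
    · exact Or.inl (hw.2 u hue)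
    · exact hpair u hue v hve huv

/-- Existence of uniform hypergraphs with many edges and no short cycles. -/
theorem exists_hasLeaves [Fintype V] {r s D M : ℕ} (hr : 0 < r) (hs : 0 < s)
    (hM : 2 * (r + 1) * M ≤ D * Fintype.card V)
    (hB : 2 * (r * (1 + D * (r + 1)) ^ s) ≤ Fintype.card V) :
    ∃ H : Finset (Finset V), #H = M ∧ (∀ e ∈ H, #e = r + 1) ∧ HasLeaves (s + 1) H := by
  suffices h : ∀ m ≤ M, ∃ H : Finset (Finset V), #H = m ∧ (∀ e ∈ H, #e = r + 1) ∧
      (∀ v, #(H.filter (v ∈ ·)) ≤ D) ∧ HasLeaves (s + 1) H by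
    obtain ⟨H, h1, h2, -, h3⟩ := h M le_rfl
    exact ⟨H, h1, h2, h3⟩
  intro m
  induction m with
  | zero => exact fun _ => ⟨∅, by simp [hasLeaves_empty]⟩
  | succ m ih =>
    intro hm
    obtain ⟨H, hcard, hunif, hdeg, hleaves⟩ := ih (by omega)
    let X : Finset V := univ.filter fun v => #(H.filter (v ∈ ·)) = D
    have hX : #X * D ≤ m * (r + 1) := by
      calc #X * D = ∑ v ∈ X, #(H.filter (v ∈ ·)) := by
            rw [sum_congr rfl fun v hv => (mem_filter.1 hv).2, sum_const, smul_eq_mul]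
        _ ≤ ∑ v, #(H.filter (v ∈ ·)) := sum_le_sum_of_subset (subset_univ _)
        _ = ∑ e ∈ H, #e := by
            simp only [card_filter]
            rw [sum_comm]
            simp
        _ = m * (r + 1) := by rw [sum_congr rfl hunif, sum_const, smul_eq_mul, hcard]
    have hX2 : 2 * #X < Fintype.card V := by
      by_contra! hcon
      have := Nat.mul_le_mul_left D hcon
      nlinarith
    obtain ⟨e, hecard, hedisj, hepair⟩ := exists_finset_card_eq_pairwise_notMem X
      (hyperball H s) (card_hyperball_le (fun e he => (hunif e he).le) hdeg s)
      (self_mem_hyperball H s) (r + 1) (by simp only [Nat.add_sub_cancel]; omega)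
    have hfar : ∀ S ⊆ H, #S ≤ s → ∀ u ∈ e, ∀ v ∈ e, Connects S u v → u = v := by
      intro S hS hSs u hu v hv huv
      by_contra hne
      rcases hepair u hu v hv hne with h | h
      · exact h (huv.mem_hyperball hS hSs)
      · exact h (huv.symm.mem_hyperball hS hSs)
    have heH : e ∉ H := by
      intro h
      obtain ⟨u, hu, v, hv, huv⟩ := one_lt_card.1 (show 1 < #e by omega)
      exact huv (hfar {e} (by simpa using h) (by rwa [card_singleton]) u hu v hv
        (.single ⟨e, by simp, hu, hv⟩))
    refine ⟨insert e H, by rw [card_insert_of_notMem heH, hcard], ?_, ?_,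
      hleaves.insert hfar⟩
    · intro f hf
      rcases mem_insert.1 hf with rfl | hf
      exacts [hecard, hunif f hf]
    · intro v
      rw [filter_insert]
      split_ifs with hve
      · have : v ∉ X := disjoint_left.1 hedisj hve
        have hne : #(H.filter (v ∈ ·)) ≠ D := fun h => this (by simp [X, h])
        have := hdeg v
        exact (card_insert_le _ _).trans (by omega)
      · exact hdeg v

end Hypergraph

section Code

variable {F : Type*} [Field F]

/-- The code on coordinates indexed by `ι` whose parity checks are the indicator functions
of the blocks and the first `l` positive power functions of the evaluation points. -/
def blockCode {ι β : Type*} [Fintype ι] [DecidableEq β] (blk : ι → β) (pt : ι → F) (l : ℕ) :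
    Submodule F (ι → F) where
  carrier := {c | (∀ b, ∑ i with blk i = b, c i = 0) ∧
    ∀ j < l, ∑ i, c i * pt i ^ (j + 1) = 0}
  zero_mem' := by simp
  add_mem' := by
    rintro x y ⟨hx, hx'⟩ ⟨hy, hy'⟩
    refine ⟨fun b => ?_, fun j hj => ?_⟩
    · simp [sum_add_distrib, hx b, hy b]
    · simp [add_mul, sum_add_distrib, hx' j hj, hy' j hj]
  smul_mem' := by
    rintro a x ⟨hx, hx'⟩
    refine ⟨fun b => ?_, fun j hj => ?_⟩
    · simp [← mul_sum, hx b]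
    · simp [mul_assoc, ← mul_sum, hx' j hj]

theorem card_le_finrank_blockCode {ι β : Type*} [Fintype ι] [Fintype β] [DecidableEq β]
    (blk : ι → β) (pt : ι → F) (l : ℕ) :
    Fintype.card ι ≤ Module.finrank F (blockCode blk pt l) + (Fintype.card β + l) := by
  let φ : (ι → F) →ₗ[F] (β → F) × (Fin l → F) :=
    (LinearMap.pi fun b => ∑ i with blk i = b, LinearMap.proj i).prod
      (LinearMap.pi fun j => ∑ i, pt i ^ ((j : ℕ) + 1) • LinearMap.proj i)
  have hker : LinearMap.ker φ ≤ blockCode blk pt l := by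
    intro c hc
    have hc' := Prod.ext_iff.1 (LinearMap.mem_ker.1 hc)
    refine ⟨fun b => ?_, fun j hj => ?_⟩
    · simpa [φ] using congrFun hc'.1 b
    · simpa [φ, mul_comm] using congrFun hc'.2 ⟨j, hj⟩
  have h1 := φ.finrank_range_add_finrank_ker
  have h2 := Submodule.finrank_mono hker
  have h3 := (LinearMap.range φ).finrank_le
  simp only [Module.finrank_prod, Module.finrank_fintype_fun_eq_card, Fintype.card_fin]
    at h1 h3
  omega

/-- Block codes built from the edges of a hypergraph without short cycles have large
minimum distance. -/
theorem lt_hammingNorm_of_mem_blockCode [DecidableEq F] {ι : Type*} [Fintype ι] {β : Type*}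
    [DecidableEq β] {blk : ι → β} {pt : ι → F} {l t : ℕ} (hl : l + 1 ≤ 2 * t + 1)
    {edge : β → Finset F} (hedge : Function.Injective edge) {H : Finset (Finset F)} (hH : HasLeaves t H)
    (hmemH : ∀ b, edge b ∈ H) (hpt : ∀ i, pt i ∈ edge (blk i))
    (hinj : ∀ i j, blk i = blk j → pt i = pt j → i = j)
    {c : ι → F} (hc : c ∈ blockCode blk pt l) (hc0 : c ≠ 0) : l + 1 < hammingNorm c := by
  classical
  obtain ⟨hblk, hpow⟩ := hc
  by_contra! hle
  let E : Finset ι := univ.filter (c · ≠ 0)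
  have hE : #E ≤ l + 1 := hle
  let S : Finset (Finset F) := E.image fun i => edge (blk i)
  let g : Finset F → Finset F := fun e => (E.filter fun i => edge (blk i) = e).image pt
  have hgcard : ∀ e, #(g e) = #(E.filter fun i => edge (blk i) = e) := fun e => by
    refine card_image_of_injOn fun i hi j hj hij => hinj i j (hedge ?_) hij
    exact (mem_filter.1 hi).2.trans (mem_filter.1 hj).2.symm
  have hg : ∀ e ∈ S, g e ⊆ e ∧ 2 ≤ #(g e) := by
    intro e he
    obtain ⟨i, hi, rfl⟩ := mem_image.1 he
    refine ⟨fun x hx => ?_, ?_⟩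
    · obtain ⟨j, hj, rfl⟩ := mem_image.1 hx
      exact (mem_filter.1 hj).2 ▸ hpt j
    · rw [hgcard]
      by_contra! hlt
      have hall : ∀ j, blk j = blk i → j ≠ i → c j = 0 := by
        intro j hj hji
        by_contra hcj
        exact hji (card_le_one.1 (Nat.le_of_lt_succ hlt) j (by simp [E, hcj, hj]) i
          (by simpa using hi))
      have := hblk (blk i)
      rw [sum_eq_single_of_mem i (by simp)
        fun j hj hji => hall j (mem_filter.1 hj).2 hji] at this
      exact (mem_filter.1 hi).2 this
  have hScard : #S * 2 ≤ l + 1 := by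
    refine le_trans ?_ hE
    rw [card_eq_sum_card_image (fun i => edge (blk i)) E]
    rw [← smul_eq_mul]
    refine card_nsmul_le_sum _ _ _ fun e he => ?_
    rw [← hgcard]
    exact (hg e he).2
  have hEne : E.Nonempty := by
    obtain ⟨i, hi⟩ := Function.ne_iff.1 hc0
    exact ⟨i, by simpa [E] using hi⟩
  obtain ⟨x, -, -, ⟨e, ⟨-, hxe⟩, huniq⟩, -⟩ := hH S
    (fun e he => by obtain ⟨i, -, rfl⟩ := mem_image.1 he; exact hmemH _)
    (hEne.image _) (by omega) g hg
  obtain ⟨i, hi, rfl⟩ := mem_image.1 hxe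
  obtain ⟨hiE, hie⟩ := mem_filter.1 hi
  have hsingle : ∀ j ∈ E, pt j = pt i → j = i := by
    intro j hj hji
    refine hinj j i (hedge ?_) hji
    rw [hie]
    exact huniq _ ⟨mem_image_of_mem _ hj, hji ▸ mem_image_of_mem _ (by simp [hj])⟩
  have hpoly : ∀ p : Polynomial F, p.natDegree ≤ l → ∑ j, c j * p.eval (pt j) = 0 := by
    intro p hp
    have hpow' : ∀ k ≤ l, ∑ j, c j * pt j ^ k = 0 := by
      rintro (_ | k) hk
      · have hfib := sum_fiberwise_of_maps_to (s := univ) (t := univ.image blk) (g := blk)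
          (fun i _ => mem_image_of_mem _ (mem_univ i)) c
        simp only [pow_zero, mul_one]
        rw [← hfib]
        exact sum_eq_zero fun b _ => hblk b
      · exact hpow k hk
    simp only [Polynomial.eval_eq_sum_range, mul_sum]
    rw [sum_comm]
    refine sum_eq_zero fun k hk => ?_
    have := hpow' k (by have := mem_range.1 hk; omega)
    simp only [mul_left_comm (c _), ← mul_sum, this, mul_zero]
  let p : Polynomial F := ∏ j ∈ E.erase i, (Polynomial.X - Polynomial.C (pt j))
  have hdeg : p.natDegree ≤ l := by
    rw [Polynomial.natDegree_finsetProd_X_sub_C_eq_card, card_erase_of_mem hiE]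
    omega
  have hsum := hpoly p hdeg
  rw [sum_eq_single i] at hsum
  · refine (mul_ne_zero (mem_filter.1 hiE).2 ?_) hsum
    rw [Polynomial.eval_prod]
    refine prod_ne_zero_iff.2 fun j hj => ?_
    obtain ⟨hji, hjE⟩ := mem_erase.1 hj
    simpa [sub_eq_zero] using fun h : pt i = pt j => hji (hsingle j hjE h.symm)
  · intro j _ hji
    by_cases hjE : j ∈ E
    · rw [Polynomial.eval_prod, prod_eq_zero (mem_erase.2 ⟨hji, hjE⟩) (by simp), mul_zero]
    · have : c j = 0 := by simpa [E] using hjE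
      rw [this, zero_mul]
  · simp

theorem hasLocality_blockCode [DecidableEq F] {n r : ℕ} {β : Type*} [DecidableEq β]
    {blk : Fin n → β} (pt : Fin n → F) (l : ℕ) (hblk : ∀ b, #{i | blk i = b} ≤ r + 1) :
    HasLocality (blockCode blk pt l) r := by
  intro i
  refine ⟨fun j => if blk j = blk i then 1 else 0, fun c hc => ?_, by simp, ?_⟩
  · simpa [sum_filter] using hc.1 (blk i)
  · simpa [hammingNorm] using hblk (blk i)

end Code

/-- The numerical estimate behind the choice of the constant in the length bound. -/
theorem degree_bound {r s n q : ℕ} (hs : 0 < s) (hq : 0 < q) (hqn : q ≤ n)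
    (hn : (n : ℝ) ≤ 1 / (12 * ((r : ℝ) + 1) ^ 2) * (q : ℝ) ^ ((1 : ℝ) + 1 / (s : ℝ))) :
    2 * (r * (1 + (4 * n / q + 1) * (r + 1)) ^ s) ≤ q := by
  have hq' : (0 : ℝ) < q := by exact_mod_cast hq
  have hr : (0 : ℝ) < (r : ℝ) + 1 := by positivity
  have hqn' : (1 : ℝ) ≤ n / q := by
    rw [le_div_iff₀ hq']
    simpa using (by exact_mod_cast hqn : (q : ℝ) ≤ n)
  have hx : (n : ℝ) / q ≤ 1 / (12 * ((r : ℝ) + 1) ^ 2) * (q : ℝ) ^ (1 / (s : ℝ)) := by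
    rw [div_le_iff₀ hq']
    rw [Real.rpow_add hq', Real.rpow_one] at hn
    linarith
  have hD : ((4 * n / q : ℕ) : ℝ) ≤ 4 * (n / q) := by
    refine Nat.cast_div_le.trans (le_of_eq ?_)
    push_cast
    ring
  have hbase : (1 : ℝ) + ((4 * n / q : ℕ) + 1) * (r + 1) ≤
      1 / (2 * ((r : ℝ) + 1)) * (q : ℝ) ^ (1 / (s : ℝ)) := by
    calc (1 : ℝ) + ((4 * n / q : ℕ) + 1) * (r + 1)
        ≤ (n / q) * (r + 1) + (4 * (n / q) + n / q) * (r + 1) := by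
          gcongr
          nlinarith [(Nat.cast_nonneg r : (0 : ℝ) ≤ r)]
      _ = (6 * (r + 1)) * (n / q) := by ring
      _ ≤ (6 * (r + 1)) * (1 / (12 * ((r : ℝ) + 1) ^ 2) * (q : ℝ) ^ (1 / (s : ℝ))) := by
          gcongr
      _ = _ := by field_simp; norm_num
  have hpow : ((1 : ℝ) + ((4 * n / q : ℕ) + 1) * (r + 1)) ^ s ≤
      1 / (2 * ((r : ℝ) + 1)) * q := by
    calc _ ≤ (1 / (2 * ((r : ℝ) + 1)) * (q : ℝ) ^ (1 / (s : ℝ))) ^ s := by gcongr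
      _ = (1 / (2 * ((r : ℝ) + 1))) ^ s * q := by
          rw [mul_pow, one_div (s : ℝ), Real.rpow_inv_natCast_pow hq'.le hs.ne']
      _ ≤ _ := by
          gcongr
          refine pow_le_of_le_one (by positivity) ?_ hs.ne'
          rw [div_le_one (by positivity)]
          linarith [(Nat.cast_nonneg r : (0 : ℝ) ≤ r)]
  have hfin : (2 : ℝ) * (r * (1 + ((4 * n / q : ℕ) + 1) * (r + 1)) ^ s) ≤ q := by
    calc _ ≤ (2 : ℝ) * (r * (1 / (2 * ((r : ℝ) + 1)) * q)) := by gcongr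
      _ = r / (r + 1) * q := by field_simp
      _ ≤ 1 * q := by
          gcongr
          rw [div_le_one hr]
          linarith
      _ = q := one_mul _
  exact_mod_cast hfin

/-- At dimension at least `n - ⌈n/(r+1)⌉ - (d-2)` the Singleton-type bound is at most `d`. -/
theorem singleton_bound_le {d r a n k : ℕ} (hd : 2 ≤ d) (hda : d ≤ a) (har : a ≤ r)
    (hna : n % (r + 1) = a) (hk : n ≤ k + (n / (r + 1) + 1 + (d - 2))) :
    (n : ℤ) - k - ⌈(k : ℚ) / (r : ℚ)⌉ + 2 ≤ d := by
  have hr : 0 < r := by omega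
  have hn := Nat.div_add_mod n (r + 1)
  generalize n / (r + 1) = m at *
  rw [hna] at hn
  have hkm : m * r + 1 ≤ k := by
    have : (r + 1) * m = m * r + m := by ring
    omega
  have hceil : (m : ℤ) < ⌈(k : ℚ) / (r : ℚ)⌉ := by
    rw [Int.lt_ceil, lt_div_iff₀ (by exact_mod_cast hr)]
    exact_mod_cast hkm
  omega

/-- For `5 ≤ d ≤ r+2` and `d-1 < a ≤ r` there is a constant `η = η(d,r) > 0` such that
over any finite field of size `q`, for any `n ≡ a (mod r+1)` with
`q(r+1) < n ≤ η·q^{1+1/⌊(d-3)/2⌋}`, there exists an optimal LRC of length `n`, locality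
`r`, dimension `k ≥ n - ⌈n/(r+1)⌉ - (d-2)` and all nonzero weights
`≥ max(d, n - k - ⌈k/r⌉ + 2)`. -/
theorem stmt_13 {d r a : ℕ} (hd5 : 5 ≤ d) (hdr : d ≤ r + 2)
    (ha1 : d - 1 < a) (ha2 : a ≤ r) :
    ∃ η : ℝ, 0 < η ∧
      ∀ (F : Type) [Field F] [Fintype F] [DecidableEq F] (n : ℕ), 0 < n →
        n % (r + 1) = a → Fintype.card F * (r + 1) < n →
        (n : ℝ) ≤ η * (Fintype.card F : ℝ) ^
          ((1 : ℝ) + 1 / ((((d - 3) / 2 : ℕ) : ℝ))) →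
        ∃ C : Submodule F (Fin n → F),
          HasLocality C r ∧
          ((n : ℤ) - ⌈(n : ℚ) / ((r : ℚ) + 1)⌉ - ((d : ℤ) - 2) ≤
            (Module.finrank F ↥C : ℤ)) ∧
          (∀ c ∈ C, c ≠ 0 → d ≤ hammingNorm c) ∧
          (∀ c ∈ C, c ≠ 0 →
            (n : ℤ) - (Module.finrank F ↥C : ℤ) -
                ⌈(Module.finrank F ↥C : ℚ) / (r : ℚ)⌉ + 2 ≤ (hammingNorm c : ℤ)) := by
  have hr : 0 < r := by omega
  have hs : 0 < (d - 3) / 2 := by omega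
  refine ⟨1 / (12 * ((r : ℝ) + 1) ^ 2), by positivity, ?_⟩
  intro F _ _ _ n _ hna hqn hn
  have hq : 0 < Fintype.card F := Fintype.card_pos
  have hrn : r + 1 ≤ n := (Nat.le_mul_of_pos_left _ hq).trans hqn.le
  have hdiv := Nat.div_add_mod n (r + 1)
  have hM : 2 * (r + 1) * (n / (r + 1) + 1) ≤
      (4 * n / Fintype.card F + 1) * Fintype.card F := by
    have h1 := Nat.lt_div_mul_add (a := 4 * n) hq
    have h2 : 2 * (r + 1) * (n / (r + 1) + 1) = 2 * ((r + 1) * (n / (r + 1))) + 2 * (r + 1) := by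
      ring
    rw [add_mul, one_mul]
    omega
  obtain ⟨H, hHcard, hunif, hleaves⟩ := exists_hasLeaves (V := F) hr hs hM
    (degree_bound hs hq ((Nat.le_mul_of_pos_right _ r.succ_pos).trans hqn.le) hn)
  let edge : Fin (n / (r + 1) + 1) → Finset F := fun b => (H.equivFinOfCardEq hHcard).symm b
  have hmemH : ∀ b, edge b ∈ H := fun b => ((H.equivFinOfCardEq hHcard).symm b).2
  have hedge : Function.Injective edge :=
    Subtype.val_injective.comp (H.equivFinOfCardEq hHcard).symm.injective
  let blk : Fin n → Fin (n / (r + 1) + 1) := fun i =>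
    ⟨i / (r + 1), Nat.lt_succ_of_le (Nat.div_le_div_right i.2.le)⟩
  let pos : Fin n → Fin (r + 1) := fun i => ⟨i % (r + 1), Nat.mod_lt _ r.succ_pos⟩
  have hblkpos : ∀ i j, blk i = blk j → pos i = pos j → i = j := by
    intro i j hb hp
    have hb' : (i : ℕ) / (r + 1) = j / (r + 1) := congrArg Fin.val hb
    have hp' : (i : ℕ) % (r + 1) = j % (r + 1) := congrArg Fin.val hp
    rw [Fin.ext_iff, ← Nat.div_add_mod (i : ℕ) (r + 1), hb', hp', Nat.div_add_mod]
  let enum : ∀ b, edge b ≃ Fin (r + 1) := fun b =>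
    (edge b).equivFinOfCardEq (hunif _ (hmemH b))
  let pt : Fin n → F := fun i => (enum (blk i)).symm (pos i)
  have hinj : ∀ i j, blk i = blk j → pt i = pt j → i = j := by
    intro i j hb hp
    refine hblkpos i j hb ?_
    simp only [pt] at hp
    rw [hb] at hp
    exact (enum (blk j)).symm.injective (Subtype.ext hp)
  have hdist : ∀ c ∈ blockCode blk pt (d - 2), c ≠ 0 → d ≤ hammingNorm c := by
    intro c hc hc0
    have := lt_hammingNorm_of_mem_blockCode (by omega) hedge hleaves hmemH
      (fun i => ((enum (blk i)).symm (pos i)).2) hinj hc hc0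
    omega
  have hdim := card_le_finrank_blockCode blk pt (d - 2)
  simp only [Fintype.card_fin] at hdim
  refine ⟨blockCode blk pt (d - 2), hasLocality_blockCode pt _ fun b => ?_, ?_, hdist, ?_⟩
  · refine (card_le_card_of_injOn pos (fun _ _ => mem_univ _) fun i hi j hj hij =>
      hblkpos i j ?_ hij).trans (card_fin _).le
    exact (mem_filter.1 hi).2.trans (mem_filter.1 hj).2.symm
  · have hceil : ((n / (r + 1) : ℕ) : ℤ) < ⌈(n : ℚ) / ((r : ℚ) + 1)⌉ := by
      rw [Int.lt_ceil, lt_div_iff₀ (by positivity)]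
      have : n / (r + 1) * (r + 1) < n := by
        rw [mul_comm]
        omega
      exact_mod_cast this
    omega
  · intro c hc hc0
    exact (singleton_bound_le (by omega) (by omega) ha2 hna hdim).trans
      (by exact_mod_cast hdist c hc hc0)
end
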